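/- Let (E_n) be the external DLA process on Z^2 started from E_0 = {0}, where at each step a new vertex is added to the boundary of the current cluster according to the harmonic measure from infinity. Then there exists a constant C(2) < ∞ such that, with probability 1, limsup_{n→∞} n^{-2/3} r(E_n) ≤ C(2), where r(E_n) = max{|x| : x ∈ E_n} is the (Euclidean) radius of the cluster. -/

import Mathlib

open MeasureTheory Filter Topology

/-- The lattice neighbors of a point of `ℤ^d` (the `2d` points at `ℓ¹`-distance one). -/
noncomputable def latNbrs {d : ℕ} (x : Fin d → ℤ) : Finset (Fin d → ℤ) :=
  (Finset.univ ×ˢ ({1, -1} : Finset ℤ)).image (fun p => Function.update x p.1 (x p.1 + p.2))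

open Classical in
/-- Probability that the random walk which at each step moves uniformly to one of the
points in `nbr ·`, started at `x`, hits the set `A` within `n` steps, with first
hitting position `y`. -/
noncomputable def hitP {V : Type*} (nbr : V → Finset V) (A : Set V) : ℕ → V → V → ℝ
  | 0, x, y => if x ∈ A ∧ x = y then 1 else 0
  | n+1, x, y =>
      if x ∈ A then (if x = y then 1 else 0)
      else ((nbr x).card : ℝ)⁻¹ * ∑ z ∈ nbr x, hitP nbr A n z y

/-- The hitting distribution `H_A(x,y)`: probability that the random walk started at `x`
ever hits `A`, with first hitting position `y` (monotone limit of `hitP`). -/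
noncomputable def hitMeas {V : Type*} (nbr : V → Finset V) (A : Set V) (x y : V) : ℝ :=
  ⨆ n, hitP nbr A n x y

/-- Outer boundary of a finite set. -/
noncomputable def bdryF {V : Type*} [DecidableEq V] (nbr : V → Finset V) (A : Finset V) :
    Finset V :=
  A.biUnion nbr \ A

/-- Euclidean norm of a lattice point. -/
noncomputable def eunorm {d : ℕ} (x : Fin d → ℤ) : ℝ := Real.sqrt (∑ i, ((x i : ℝ)) ^ 2)

/-- Radius of a cluster: `r(A) = max {|x| : x ∈ A}`. -/
noncomputable def radE {d : ℕ} (A : Finset (Fin d → ℤ)) : ℝ := ⨆ x ∈ A, eunorm x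

lemma latNbrs_eq (x : Fin 2 → ℤ) :
    latNbrs x = {x + ![1, 0], x + ![-1, 0], x + ![0, 1], x + ![0, -1]} := by
  have h : (Finset.univ ×ˢ ({1, -1} : Finset ℤ) : Finset (Fin 2 × ℤ))
      = {(0, 1), (0, -1), (1, 1), (1, -1)} := by decide
  have e : ∀ (i : Fin 2) (c : ℤ), Function.update x i (x i + c) = x + Pi.single i c := by
    intro i c
    ext j
    by_cases hj : j = i
    · subst hj; simp
    · simp [hj]
  have s0 : ∀ c : ℤ, (Pi.single (0 : Fin 2) c : Fin 2 → ℤ) = ![c, 0] := by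
    intro c; ext j; fin_cases j <;> simp
  have s1 : ∀ c : ℤ, (Pi.single (1 : Fin 2) c : Fin 2 → ℤ) = ![0, c] := by
    intro c; ext j; fin_cases j <;> simp
  simp [latNbrs, h, e, s0, s1, Finset.image_insert]

lemma sum_latNbrs {M : Type*} [AddCommMonoid M] (f : (Fin 2 → ℤ) → M) (x : Fin 2 → ℤ) :
    ∑ z ∈ latNbrs x, f z
      = f (x + ![1, 0]) + (f (x + ![-1, 0]) + (f (x + ![0, 1]) + f (x + ![0, -1]))) := by
  rw [latNbrs_eq, Finset.sum_insert, Finset.sum_insert, Finset.sum_insert, Finset.sum_singleton]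
  all_goals
    simp [funext_iff]

lemma card_latNbrs (x : Fin 2 → ℤ) : (latNbrs x).card = 4 := by
  rw [Finset.card_eq_sum_ones, sum_latNbrs]; rfl

lemma mem_latNbrs_comm {x y : Fin 2 → ℤ} (h : y ∈ latNbrs x) : x ∈ latNbrs y := by
  rw [latNbrs_eq] at h ⊢
  simp only [Finset.mem_insert, Finset.mem_singleton, funext_iff, Fin.forall_fin_two, Pi.add_apply,
    Matrix.cons_val_zero, Matrix.cons_val_one] at h ⊢
  omega

lemma sq_eunorm (x : Fin 2 → ℤ) : eunorm x ^ 2 = (x 0 : ℝ) ^ 2 + (x 1 : ℝ) ^ 2 := by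
  rw [eunorm, Real.sq_sqrt (by positivity), Fin.sum_univ_two]

lemma eunorm_nonneg {d : ℕ} (x : Fin d → ℤ) : 0 ≤ eunorm x := Real.sqrt_nonneg _

lemma eunorm_eq_norm {d : ℕ} (x : Fin d → ℤ) :
    eunorm x = ‖(WithLp.toLp 2 (fun i => (x i : ℝ)) : EuclideanSpace ℝ (Fin d))‖ := by
  rw [EuclideanSpace.norm_eq, eunorm]
  simp

lemma eunorm_add_le {d : ℕ} (x y : Fin d → ℤ) : eunorm (x + y) ≤ eunorm x + eunorm y := by
  simp only [eunorm_eq_norm]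
  refine le_trans (le_of_eq ?_) (norm_add_le _ _)
  congr 1
  ext i
  simp

lemma eunorm_neg {d : ℕ} (x : Fin d → ℤ) : eunorm (-x) = eunorm x := by
  simp [eunorm]

lemma eunorm_sub_le {d : ℕ} (x y z : Fin d → ℤ) :
    eunorm (x - z) ≤ eunorm (x - y) + eunorm (y - z) := by
  simpa using eunorm_add_le (x - y) (y - z)

lemma eunorm_sub_comm {d : ℕ} (x y : Fin d → ℤ) : eunorm (x - y) = eunorm (y - x) := by
  rw [← eunorm_neg, neg_sub]

lemma one_le_eunorm {x : Fin 2 → ℤ} (hx : x ≠ 0) : 1 ≤ eunorm x := by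
  have h : (1 : ℤ) ≤ x 0 ^ 2 + x 1 ^ 2 := by
    by_contra! h
    apply hx
    have h0 : x 0 = 0 := by nlinarith [sq_nonneg (x 0), sq_nonneg (x 1)]
    have h1 : x 1 = 0 := by nlinarith [sq_nonneg (x 0), sq_nonneg (x 1)]
    ext i; fin_cases i <;> simp [h0, h1]
  have h' : (1 : ℝ) ≤ eunorm x ^ 2 := by rw [sq_eunorm]; exact_mod_cast h
  nlinarith [eunorm_nonneg x]

lemma eunorm_sub_of_mem_latNbrs {x y : Fin 2 → ℤ} (h : y ∈ latNbrs x) : eunorm (y - x) = 1 := by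
  rw [latNbrs_eq] at h
  simp only [Finset.mem_insert, Finset.mem_singleton] at h
  rcases h with rfl | rfl | rfl | rfl <;> simp only [add_sub_cancel_left] <;> simp [eunorm]

lemma eunorm_zero {d : ℕ} : eunorm (0 : Fin d → ℤ) = 0 := by simp [eunorm]

/-- A regularised logarithm that is discretely subharmonic on all of `ℤ²`. -/
noncomputable def subLog (x : Fin 2 → ℤ) : ℝ := Real.log (eunorm x ^ 2 + 1 / 2) / 2

/-- The argument of the logarithm in `superLog`. -/
noncomputable def superLogArg (x : Fin 2 → ℤ) : ℝ :=
  if x = 0 then 1 / 200 else eunorm x ^ 2 - 1 / 2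

/-- A regularised logarithm that is discretely superharmonic on `ℤ² \ {0}`. -/
noncomputable def superLog (x : Fin 2 → ℤ) : ℝ := Real.log (superLogArg x) / 2

lemma superLogArg_pos (x : Fin 2 → ℤ) : 0 < superLogArg x := by
  unfold superLogArg
  split_ifs with h
  · norm_num
  · nlinarith [one_le_eunorm h]

lemma subLog_le_average (x : Fin 2 → ℤ) :
    4 * subLog x ≤ ∑ z ∈ latNbrs x, subLog z := by
  rw [sum_latNbrs]
  simp only [subLog, sq_eunorm]
  set a : ℝ := (x 0 : ℝ) with ha
  set b : ℝ := (x 1 : ℝ) with hb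
  have h1 : 0 < (a + 1) ^ 2 + b ^ 2 + 1 / 2 := by positivity
  have h2 : 0 < (a - 1) ^ 2 + b ^ 2 + 1 / 2 := by positivity
  have h3 : 0 < a ^ 2 + (b + 1) ^ 2 + 1 / 2 := by positivity
  have h4 : 0 < a ^ 2 + (b - 1) ^ 2 + 1 / 2 := by positivity
  have h0 : 0 < a ^ 2 + b ^ 2 + 1 / 2 := by positivity
  have key : Real.log ((a ^ 2 + b ^ 2 + 1 / 2) ^ 4) ≤
      Real.log (((a + 1) ^ 2 + b ^ 2 + 1 / 2) * (((a - 1) ^ 2 + b ^ 2 + 1 / 2) *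
        ((a ^ 2 + (b + 1) ^ 2 + 1 / 2) * (a ^ 2 + (b - 1) ^ 2 + 1 / 2)))) := by
    apply Real.log_le_log (by positivity)
    nlinarith [sq_nonneg (a * b), sq_nonneg a, sq_nonneg b]
  rw [Real.log_pow, Real.log_mul h1.ne' (by positivity), Real.log_mul h2.ne' (by positivity),
    Real.log_mul h3.ne' h4.ne'] at key
  simp only [Pi.add_apply, Matrix.cons_val_zero, Matrix.cons_val_one, Int.cast_add, Int.cast_one,
    Int.cast_neg, add_zero]
  rw [← ha, ← hb, ← sub_eq_add_neg, ← sub_eq_add_neg]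
  push_cast at key
  linarith

lemma superLogArg_prod_le {x : Fin 2 → ℤ} (hx : x ≠ 0) :
    superLogArg (x + ![1, 0]) * (superLogArg (x + ![-1, 0]) *
      (superLogArg (x + ![0, 1]) * superLogArg (x + ![0, -1]))) ≤ superLogArg x ^ 4 := by
  have hcase : ∀ v : Fin 2 → ℤ, x + v = 0 → x = -v := fun v h => eq_neg_of_add_eq_zero_left h
  by_cases c1 : x + ![1, 0] = 0
  · obtain rfl := hcase _ c1
    simp [superLogArg, sq_eunorm]; norm_num
  by_cases c2 : x + ![-1, 0] = 0
  · obtain rfl := hcase _ c2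
    simp [superLogArg, sq_eunorm]; norm_num
  by_cases c3 : x + ![0, 1] = 0
  · obtain rfl := hcase _ c3
    simp [superLogArg, sq_eunorm]; norm_num
  by_cases c4 : x + ![0, -1] = 0
  · obtain rfl := hcase _ c4
    simp [superLogArg, sq_eunorm]; norm_num
  simp only [superLogArg, if_neg hx, if_neg c1, if_neg c2, if_neg c3, if_neg c4, sq_eunorm,
    Pi.add_apply, Matrix.cons_val_zero, Matrix.cons_val_one, Int.cast_add, Int.cast_one,
    Int.cast_neg, add_zero]
  set a : ℝ := (x 0 : ℝ)
  set b : ℝ := (x 1 : ℝ)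
  have : (a ^ 2 + b ^ 2 - 1 / 2) ^ 4 - ((a + 1) ^ 2 + b ^ 2 - 1 / 2) *
      (((a + -1) ^ 2 + b ^ 2 - 1 / 2) *
        ((a ^ 2 + (b + 1) ^ 2 - 1 / 2) * (a ^ 2 + (b + -1) ^ 2 - 1 / 2)))
      = 4 * (a ^ 2 - b ^ 2) ^ 2 := by ring
  nlinarith [sq_nonneg (a ^ 2 - b ^ 2)]

lemma average_superLog_le {x : Fin 2 → ℤ} (hx : x ≠ 0) :
    ∑ z ∈ latNbrs x, superLog z ≤ 4 * superLog x := by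
  rw [sum_latNbrs]
  have key := Real.log_le_log (by simp only [mul_pos_iff_of_pos_left, superLogArg_pos])
    (superLogArg_prod_le hx)
  have hp := fun v => (superLogArg_pos v).ne'
  rw [Real.log_pow, Real.log_mul (hp _) (mul_ne_zero (hp _) (mul_ne_zero (hp _) (hp _))),
    Real.log_mul (hp _) (mul_ne_zero (hp _) (hp _)), Real.log_mul (hp _) (hp _)] at key
  simp only [superLog]
  push_cast at key
  linarith

lemma subLog_le {x : Fin 2 → ℤ} (hx : x ≠ 0) :
    subLog x ≤ Real.log (eunorm x) + 1 / (4 * eunorm x ^ 2) := by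
  have h := one_le_eunorm hx
  have h2 : Real.log (eunorm x ^ 2 + 1 / 2) =
      Real.log (eunorm x ^ 2) + Real.log (1 + 1 / (2 * eunorm x ^ 2)) := by
    rw [← Real.log_mul (by positivity) (by positivity)]
    congr 1; field_simp
  have h3 := Real.log_le_sub_one_of_pos (show 0 < 1 + 1 / (2 * eunorm x ^ 2) by positivity)
  rw [Real.log_pow] at h2
  have h4 : 1 / (4 * eunorm x ^ 2) = 1 / (2 * eunorm x ^ 2) / 2 := by field_simp; norm_num
  rw [subLog, h2, h4]
  push_cast
  linarith

lemma log_sub_le_superLog (x : Fin 2 → ℤ) :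
    Real.log (eunorm x + 1) - 11 / (eunorm x + 2) ≤ superLog x := by
  by_cases hx : x = 0
  · subst hx
    have : Real.log 200 ≤ 11 := by
      rw [Real.log_le_iff_le_exp (by norm_num)]
      have := Real.add_one_le_exp (1 : ℝ)
      have h2 : Real.exp 11 = Real.exp 1 ^ 11 := by rw [← Real.exp_nat_mul]; norm_num
      rw [h2]
      calc (200 : ℝ) ≤ 2 ^ 11 := by norm_num
        _ ≤ _ := by gcongr; linarith
    simp only [superLog, superLogArg, eunorm_zero, if_true]
    rw [one_div, Real.log_inv]
    simp; linarith
  · have h := one_le_eunorm hx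
    simp only [superLog, superLogArg, if_neg hx]
    set d := eunorm x
    have hd : 0 < d ^ 2 - 1 / 2 := by nlinarith
    have h3 := Real.log_le_sub_one_of_pos (show 0 < (d + 1) ^ 2 / (d ^ 2 - 1 / 2) by positivity)
    rw [Real.log_div (by positivity) hd.ne', Real.log_pow] at h3
    have h4 : (d + 1) ^ 2 / (d ^ 2 - 1 / 2) - 1 ≤ 2 * (11 / (d + 2)) := by
      rw [← mul_div_assoc, div_sub_one hd.ne', div_le_div_iff₀ hd (by linarith)]
      nlinarith
    push_cast at h3
    linarith

/-- In the variable `u = √r`, the primitive of the density `1 / N + 1 / u ^ 2` of the charge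
distribution placed along the arm. -/
noncomputable def armMass (N u : ℝ) : ℝ := u / N - 1 / u

/-- In the variable `u = √r`, the primitive of `(1 / N + 1 / u ^ 2) * log |1 - u ^ 2 / τ ^ 2|`. -/
noncomputable def armPot (N τ u : ℝ) : ℝ :=
  (1 / N + 1 / (u * τ)) * ((u - τ) * Real.log (u - τ))
    + (1 / N - 1 / (u * τ)) * ((u + τ) * Real.log (u + τ))
    - 2 * armMass N u * Real.log τ - 2 * u / N

lemma hasDerivAt_armMass (N : ℝ) {u : ℝ} (hu : 0 < u) :
    HasDerivAt (armMass N) (1 / N + 1 / u ^ 2) u := by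
  have h1 := (hasDerivAt_id u).div_const N
  have h2 := hasDerivAt_inv hu.ne'
  have h : HasDerivAt (fun v : ℝ => v / N - v⁻¹) (1 / N + 1 / u ^ 2) u :=
    (h1.sub h2).congr_deriv (by simp)
  have e : armMass N = fun v : ℝ => v / N - v⁻¹ := by ext v; simp [armMass]
  rwa [e]

lemma hasDerivAt_mul_log_sub {u c : ℝ} (h : u - c ≠ 0) :
    HasDerivAt (fun v : ℝ => (v - c) * Real.log (v - c)) (Real.log (u - c) + 1) u :=
  (Real.hasDerivAt_mul_log h).comp_sub_const u c

lemma hasDerivAt_armPot {N τ u : ℝ} (hτ : 0 < τ) (hu : 0 < u) (hne : u ≠ τ) (hN : 0 < N) :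
    HasDerivAt (armPot N τ)
      ((1 / N + 1 / u ^ 2) * (Real.log (u - τ) + Real.log (u + τ) - 2 * Real.log τ)) u := by
  have hi : HasDerivAt (fun v : ℝ => 1 / (v * τ)) (-(1 / (u ^ 2 * τ))) u := by
    have := ((hasDerivAt_id u).mul_const τ).inv (by simp; exact ⟨hu.ne', hτ.ne'⟩)
    have e : (fun v : ℝ => 1 / (v * τ)) = fun v : ℝ => (v * τ)⁻¹ := by ext v; simp
    rw [e]
    refine HasDerivAt.congr_deriv this ?_
    simp only [id]
    field_simp
  have hl1 := hasDerivAt_mul_log_sub (u := u) (c := τ) (sub_ne_zero.2 hne)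
  have hl2 := hasDerivAt_mul_log_sub (u := u) (c := -τ) (by linarith)
  simp only [sub_neg_eq_add] at hl2
  have h := (((((hi.const_add (1 / N)).mul hl1).add ((hi.const_sub (1 / N)).mul hl2)).sub
    (((hasDerivAt_armMass N hu).const_mul 2).mul_const (Real.log τ))).sub
      (((hasDerivAt_id u).const_mul 2).div_const N))
  refine HasDerivAt.congr_deriv (f := armPot N τ) h ?_
  field_simp
  ring

lemma continuousOn_armPot (N : ℝ) {τ : ℝ} (hτ : 0 < τ) : ContinuousOn (armPot N τ) (Set.Ioi 0) := by
  have hl : ∀ c : ℝ, Continuous (fun v : ℝ => (v + c) * Real.log (v + c)) := fun c =>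
    Real.continuous_mul_log.comp (continuous_add_const c)
  have h1 := hl (-τ)
  simp only [← sub_eq_add_neg] at h1
  have h2 := hl τ
  have hi : ContinuousOn (fun v : ℝ => 1 / (v * τ)) (Set.Ioi 0) := by
    apply ContinuousOn.div continuousOn_const (by fun_prop)
    intro x hx
    exact (mul_pos hx hτ).ne'
  have hm : ContinuousOn (armMass N) (Set.Ioi 0) := fun x hx =>
    (hasDerivAt_armMass N hx).continuousAt.continuousWithinAt
  unfold armPot
  exact ((((continuousOn_const.add hi).mul h1.continuousOn).add
    ((continuousOn_const.sub hi).mul h2.continuousOn)).sub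
      ((continuousOn_const.mul hm).mul continuousOn_const)).sub (by fun_prop)

/-- The mean value inequality on an interval with one exceptional point. -/
lemma image_le_of_hasDerivAt_nonneg_of_ne {f f' : ℝ → ℝ} {a b c : ℝ} (hab : a ≤ b)
    (hf : ContinuousOn f (Set.Icc a b))
    (hd : ∀ u ∈ Set.Ioo a b, u ≠ c → HasDerivAt f (f' u) u)
    (h0 : ∀ u ∈ Set.Ioo a b, u ≠ c → 0 ≤ f' u) : f a ≤ f b := by
  have key : ∀ x y, a ≤ x → x ≤ y → y ≤ b → (∀ u ∈ Set.Ioo x y, u ≠ c) → f x ≤ f y := by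
    intro x y hx hxy hy hc
    have hm : MonotoneOn f (Set.Icc x y) := by
      apply monotoneOn_of_hasDerivWithinAt_nonneg (f' := f') (convex_Icc x y)
        (hf.mono (Set.Icc_subset_Icc hx hy))
      · intro u hu
        rw [interior_Icc] at hu
        exact (hd u ⟨hx.trans_lt hu.1, hu.2.trans_le hy⟩ (hc u hu)).hasDerivWithinAt
      · intro u hu
        rw [interior_Icc] at hu
        exact h0 u ⟨hx.trans_lt hu.1, hu.2.trans_le hy⟩ (hc u hu)
    exact hm (Set.left_mem_Icc.2 hxy) (Set.right_mem_Icc.2 hxy) hxy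
  by_cases hc : c ∈ Set.Ioo a b
  · exact (key a c le_rfl hc.1.le hc.2.le fun u hu => hu.2.ne).trans
      (key c b hc.1.le hc.2.le le_rfl fun u hu => hu.1.ne')
  · exact key a b le_rfl hab le_rfl fun u hu h => hc (h ▸ hu)

lemma armPot_sub_le {N τ a b c : ℝ} (hN : 0 < N) (hτ : 0 < τ) (ha : 0 < a) (hab : a ≤ b)
    (hc : ∀ u ∈ Set.Ioo a b, u ≠ τ → Real.log (u - τ) + Real.log (u + τ) - 2 * Real.log τ ≤ c) :
    armPot N τ b - armPot N τ a ≤ (armMass N b - armMass N a) * c := by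
  have h := image_le_of_hasDerivAt_nonneg_of_ne (f := fun u => armMass N u * c - armPot N τ u)
    (f' := fun u => (1 / N + 1 / u ^ 2) * c
      - (1 / N + 1 / u ^ 2) * (Real.log (u - τ) + Real.log (u + τ) - 2 * Real.log τ))
    (c := τ) hab ?_ ?_ ?_
  · linarith
  · refine ContinuousOn.sub (ContinuousOn.mul ?_ continuousOn_const)
      ((continuousOn_armPot N hτ).mono fun x hx => ha.trans_le hx.1)
    exact fun x hx => (hasDerivAt_armMass N (ha.trans_le hx.1)).continuousAt.continuousWithinAt
  · intro u hu hne
    have hu0 := ha.trans hu.1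
    exact ((hasDerivAt_armMass N hu0).mul_const c).sub (hasDerivAt_armPot hτ hu0 hne hN)
  · intro u hu hne
    have hu0 := ha.trans hu.1
    have := hc u hu hne
    rw [← mul_sub]
    have : 0 ≤ 1 / N + 1 / u ^ 2 := by positivity
    apply mul_nonneg this
    linarith

lemma le_armPot_sqrt {τ u : ℝ} (hτ : 0 < τ) (hu : 0 < u) : -(6 / u) ≤ armPot (u ^ 2) τ u := by
  have e : armPot (u ^ 2) τ u =
      (u + τ) / (u ^ 2 * τ) * ((u - τ) * (Real.log (u - τ) - Real.log (u + τ))) - 2 / u := by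
    unfold armPot armMass
    field_simp
    ring
  rw [e]
  have key : -(4 / u) ≤ (u + τ) / (u ^ 2 * τ) *
      ((u - τ) * (Real.log (u - τ) - Real.log (u + τ))) := by
    rcases lt_trichotomy u τ with h | h | h
    · have h1 : Real.log (u - τ) ≤ Real.log (u + τ) := by
        rw [← Real.log_neg_eq_log]
        exact Real.log_le_log (by linarith) (by linarith)
      have h2 : 0 ≤ (u - τ) * (Real.log (u - τ) - Real.log (u + τ)) :=
        mul_nonneg_of_nonpos_of_nonpos (by linarith) (by linarith)
      have h3 : 0 ≤ (u + τ) / (u ^ 2 * τ) := by positivity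
      have h4 : 0 < 4 / u := by positivity
      nlinarith [mul_nonneg h3 h2]
    · subst h
      have h4 : 0 < 4 / u := by positivity
      simp; positivity
    · have hd : 0 < u - τ := by linarith
      have h1 := Real.log_le_sub_one_of_pos (show 0 < (u + τ) / (u - τ) by positivity)
      rw [Real.log_div (by positivity) hd.ne', div_sub_one hd.ne', le_div_iff₀ hd] at h1
      have h3 : 0 ≤ (u + τ) / (u ^ 2 * τ) := by positivity
      have h5 : -(2 * τ) ≤ (u - τ) * (Real.log (u - τ) - Real.log (u + τ)) := by linarith
      have h6 := mul_le_mul_of_nonneg_left h5 h3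
      refine le_trans ?_ h6
      rw [neg_le, mul_neg, neg_neg, div_mul_eq_mul_div, div_le_div_iff₀ (by positivity) hu]
      nlinarith [mul_pos hu hτ, mul_pos (mul_pos hu hτ) hd]
  have : 6 / u = 4 / u + 2 / u := by ring
  linarith

lemma two_mul_le_log_sub_log {s : ℝ} (h0 : 0 ≤ s) (h1 : s < 1) :
    2 * s ≤ Real.log (1 + s) - Real.log (1 - s) := by
  have h := Real.le_log_one_add_of_nonneg (show 0 ≤ 2 * s / (1 - s) from
    div_nonneg (by linarith) (by linarith))
  have hd : 0 < 1 - s := by linarith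
  have e : 1 + 2 * s / (1 - s) = (1 + s) / (1 - s) := by field_simp; ring
  have e2 : 2 * (2 * s / (1 - s)) / (2 * s / (1 - s) + 2) = 2 * s := by field_simp; ring
  rw [e, e2, Real.log_div (by linarith) hd.ne'] at h
  exact h

lemma min_one_sq_le {s : ℝ} (h0 : 0 ≤ s) :
    min 1 (s ^ 2) ≤ (s + 1) * Real.log (s + 1) - (s - 1) * Real.log (s - 1) := by
  rcases le_or_gt s 1 with h | h
  · refine (min_le_right _ _).trans ?_
    have hm := image_le_of_hasDerivAt_nonneg_of_ne
      (f := fun v => (v + 1) * Real.log (v + 1) - (v - 1) * Real.log (v - 1) - v ^ 2)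
      (f' := fun v => (Real.log (v + 1) + 1) - (Real.log (v - 1) + 1) - 2 * v) (c := 1) h0 ?_ ?_ ?_
    · norm_num at hm
      linarith
    · have hl : ∀ c : ℝ, Continuous (fun v : ℝ => (v + c) * Real.log (v + c)) := fun c =>
        Real.continuous_mul_log.comp (continuous_add_const c)
      have h1 := hl (-1)
      simp only [← sub_eq_add_neg] at h1
      have h2 := hl 1
      exact ((h2.sub h1).sub (by fun_prop)).continuousOn
    · intro v hv _
      have h1 := hasDerivAt_mul_log_sub (u := v) (c := 1) (by linarith [hv.2])
      have h2 := hasDerivAt_mul_log_sub (u := v) (c := -1) (by linarith [hv.1])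
      simp only [sub_neg_eq_add] at h2
      exact ((h2.sub h1).sub (hasDerivAt_pow 2 v)).congr_deriv (by simp)
    · intro v hv _
      have := two_mul_le_log_sub_log hv.1.le (hv.2.trans_le h)
      have e : Real.log (v - 1) = Real.log (1 - v) := by rw [← Real.log_neg_eq_log, neg_sub]
      rw [e, add_comm v 1]
      linarith
  · refine (min_le_left _ _).trans ?_
    have h1 : Real.log (s - 1) ≤ Real.log (s + 1) := Real.log_le_log (by linarith) (by linarith)
    have h2 : Real.log 2 ≤ Real.log (s + 1) := Real.log_le_log (by norm_num) (by linarith)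
    nlinarith [Real.log_two_gt_d9, mul_nonneg (by linarith : 0 ≤ s - 1) (sub_nonneg.2 h1)]

lemma entropy_le {s : ℝ} (h0 : 0 < s) :
    (s + 1) * Real.log (s + 1) + (s - 1) * Real.log (s - 1) - 2 * s ≤ 2 * s ^ 2 := by
  have h1 : Real.log (s + 1) ≤ s := by
    have := Real.log_le_sub_one_of_pos (show 0 < s + 1 by linarith)
    linarith
  have h2 : (s + 1) * Real.log (s + 1) ≤ (s + 1) * s := by gcongr
  have h3 : (s - 1) * Real.log (s - 1) ≤ s + (s - 1) ^ 2 - (1 - s) ^ 2 + s ^ 2 := by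
    rcases lt_trichotomy s 1 with h | h | h
    · have hd : 0 < 1 - s := by linarith
      have e : Real.log (s - 1) = Real.log (1 - s) := by rw [← Real.log_neg_eq_log, neg_sub]
      have := Real.one_sub_inv_le_log_of_pos hd
      have h5 := mul_le_mul_of_nonneg_left this hd.le
      have e3 : (1 - s) * (1 - (1 - s)⁻¹) = -s := by field_simp; ring
      rw [e]
      nlinarith
    · subst h; simp
    · have := Real.log_le_sub_one_of_pos (show 0 < s - 1 by linarith)
      have := mul_le_mul_of_nonneg_left this (by linarith : 0 ≤ s - 1)
      nlinarith
  nlinarith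

lemma mul_armPot_le {N τ k : ℝ} (hN : 0 < N) (hτ : 1 ≤ τ) (hk : 0 < k) :
    k * armPot N τ k ≤ -min 1 (k ^ 2 / τ ^ 2) + 2 * k ^ 3 / N := by
  have hτ0 : 0 < τ := by linarith
  set s := k / τ with hs
  have hs0 : 0 < s := by positivity
  have hks : k = s * τ := by rw [hs]; field_simp
  have l1 : (s - 1) * Real.log (k - τ) = (s - 1) * (Real.log (s - 1) + Real.log τ) := by
    by_cases h : s - 1 = 0
    · simp [h]
    · rw [← Real.log_mul h hτ0.ne', hks]; ring_nf
  have l2 : Real.log (k + τ) = Real.log (s + 1) + Real.log τ := by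
    rw [← Real.log_mul (by positivity) hτ0.ne', hks]; ring_nf
  have e : k * armPot N τ k =
      -((s + 1) * Real.log (s + 1) - (s - 1) * Real.log (s - 1))
      + k * τ / N *
        ((s + 1) * Real.log (s + 1) + (s - 1) * Real.log (s - 1) - 2 * s) := by
    have e1 : (k - τ) * Real.log (k - τ) = τ * ((s - 1) * (Real.log (s - 1) + Real.log τ)) := by
      rw [← l1, hks]; ring
    have e2 : (k + τ) * Real.log (k + τ) = τ * ((s + 1) * (Real.log (s + 1) + Real.log τ)) := by
      rw [← l2, hks]; ring
    unfold armPot armMass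
    rw [e1, e2, hks]
    field_simp
    ring
  rw [e]
  have h1 := min_one_sq_le hs0.le
  have h2 := mul_le_mul_of_nonneg_left (entropy_le hs0) (show 0 ≤ k * τ / N by positivity)
  have h3 : k * τ / N * (2 * s ^ 2) ≤ 2 * k ^ 3 / N := by
    have : k * τ / N * (2 * s ^ 2) = 2 * k ^ 3 / N * (1 / τ) := by rw [hs]; field_simp
    rw [this]
    exact mul_le_of_le_one_right (by positivity) (by rw [div_le_one hτ0]; exact hτ)
  have h4 : k ^ 2 / τ ^ 2 = s ^ 2 := by rw [hs, div_pow]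
  rw [h4]
  linarith

/-- The charge placed on the arm at distance about `i` from its tip. -/
noncomputable def armCharge (k : ℝ) (N i : ℕ) : ℝ :=
  k * (armMass N √((i : ℝ) + 1) - armMass N √(i : ℝ))

lemma armCharge_nonneg {k : ℝ} {N i : ℕ} (hk : 0 ≤ k) (hi : 1 ≤ i) : 0 ≤ armCharge k N i := by
  have h1 : (1 : ℝ) ≤ i := by exact_mod_cast hi
  have h2 : √(i : ℝ) ≤ √((i : ℝ) + 1) := Real.sqrt_le_sqrt (by linarith)
  have h3 : 0 < √(i : ℝ) := Real.sqrt_pos.2 (by linarith)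
  apply mul_nonneg hk
  unfold armMass
  have h4 : √(i : ℝ) / N ≤ √((i : ℝ) + 1) / N := by gcongr
  have h5 : 1 / √((i : ℝ) + 1) ≤ 1 / √(i : ℝ) := by gcongr
  linarith

lemma armCharge_le {k : ℝ} {N i : ℕ} (hk : 0 ≤ k) (hi : 1 ≤ i) (hN : i < N) :
    armCharge k N i ≤ k / (i * √(i : ℝ)) := by
  have h1 : (1 : ℝ) ≤ i := by exact_mod_cast hi
  have hN' : (i : ℝ) + 1 ≤ N := by exact_mod_cast hN
  unfold armCharge armMass
  set x := √(i : ℝ) with hx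
  set y := √((i : ℝ) + 1) with hy
  have hxx : x ^ 2 = i := Real.sq_sqrt (by linarith)
  have hyy : y ^ 2 = i + 1 := Real.sq_sqrt (by linarith)
  have hx0 : 0 < x := Real.sqrt_pos.2 (by linarith)
  have hxy : x ≤ y := Real.sqrt_le_sqrt (by linarith)
  have hy0 : 0 < y := by linarith
  have hd : (y - x) * (2 * x) ≤ 1 := by nlinarith
  rw [div_eq_mul_inv k]
  apply mul_le_mul_of_nonneg_left _ hk
  rw [← hxx]
  have hNN : (y - x) / N ≤ (y - x) / x ^ 2 := by
    gcongr
    linarith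
  have hb : 1 / x - 1 / y ≤ (y - x) / x ^ 2 := by
    rw [div_sub_div _ _ hx0.ne' hy0.ne', one_mul, mul_one]
    exact div_le_div_of_nonneg_left (by linarith) (by positivity) (by nlinarith)
  have hc : (y - x) / x ^ 2 + (y - x) / x ^ 2 ≤ (x ^ 2 * x)⁻¹ := by
    rw [← add_div, inv_eq_one_div, div_le_div_iff₀ (by positivity) (by positivity)]
    nlinarith [mul_le_mul_of_nonneg_right hd (sq_nonneg x)]
  have : y / N - 1 / y - (x / N - 1 / x) = (y - x) / N + (1 / x - 1 / y) := by ring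
  linarith

lemma sum_armCharge {k : ℝ} {K N : ℕ} (hk : 0 < k) (hK : (K : ℝ) = k ^ 2) (h : K ≤ N) :
    ∑ i ∈ Finset.Ico K N, armCharge k N i = 1 - k ^ 2 / N := by
  have hN : 0 < (N : ℝ) := by
    have : (K : ℝ) ≤ N := by exact_mod_cast h
    have : 0 < k ^ 2 := by positivity
    linarith
  have hs := Finset.sum_Ico_sub (hmn := h) (f := fun i => armMass N √(i : ℝ))
  simp only [Nat.cast_add, Nat.cast_one] at hs
  simp only [armCharge]
  rw [← Finset.mul_sum, hs, hK, Real.sqrt_sq hk.le]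
  unfold armMass
  have hsN : √(N : ℝ) / N = 1 / √(N : ℝ) := by
    rw [Real.sqrt_div_self']
  rw [hsN]
  field_simp
  ring

lemma sum_range_inv_le (m : ℕ) : ∑ j ∈ Finset.range m, 1 / ((j : ℝ) + 1) ≤ 2 * √(m : ℝ) := by
  induction m with
  | zero => simp
  | succ m ih =>
    rw [Finset.sum_range_succ]
    push_cast
    set x := √(m : ℝ)
    set y := √((m : ℝ) + 1)
    have hxx : x ^ 2 = m := Real.sq_sqrt (by positivity)
    have hyy : y ^ 2 = m + 1 := Real.sq_sqrt (by positivity)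
    have hx0 : 0 ≤ x := Real.sqrt_nonneg _
    have hxy : x ≤ y := Real.sqrt_le_sqrt (by linarith)
    have hy1 : 1 ≤ y := by rw [show (1 : ℝ) = √1 by simp]; exact Real.sqrt_le_sqrt (by simp)
    rw [← hyy]
    have : 1 / y ^ 2 ≤ 2 * (y - x) := by
      rw [div_le_iff₀ (by positivity)]
      have : (y - x) * (y + x) = 1 := by linarith [sq_sub_sq y x, mul_comm (y+x) (y-x)]
      nlinarith [mul_nonneg (sub_nonneg.2 hxy) (sub_nonneg.2 hy1),
        mul_nonneg (mul_nonneg (sub_nonneg.2 hxy) (sub_nonneg.2 hy1)) (by linarith : 0 ≤ y)]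
    linarith

lemma sum_near_le {t : ℝ} (ht : 1 ≤ t) (s : Finset ℕ) (hs : ∀ i ∈ s, |(i : ℝ) - t| < t / 2) :
    ∑ i ∈ s, 1 / (1 + |(i : ℝ) - t|) ≤ 6 * √t := by
  set n := ⌊t⌋₊ with hn
  have hnt : (n : ℝ) ≤ t := Nat.floor_le (by linarith)
  have htn : t < n + 1 := Nat.lt_floor_add_one t
  have hsub : s ⊆ Finset.range ((n + 1) + (n + 1)) := by
    intro i hi
    have := (abs_lt.1 (hs i hi)).2
    have h : (i : ℝ) < ((n + 1 + (n + 1) : ℕ) : ℝ) := by push_cast; linarith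
    exact Finset.mem_range.2 (by exact_mod_cast h)
  refine (Finset.sum_le_sum_of_subset_of_nonneg hsub fun _ _ _ => by positivity).trans ?_
  rw [Finset.sum_range_add, ← Finset.sum_range_reflect]
  have h1 : ∑ j ∈ Finset.range (n + 1), 1 / (1 + |((n + 1 - 1 - j : ℕ) : ℝ) - t|)
      ≤ ∑ j ∈ Finset.range (n + 1), 1 / ((j : ℝ) + 1) := by
    apply Finset.sum_le_sum
    intro j hj
    have hj' : j ≤ n := Nat.lt_succ_iff.1 (Finset.mem_range.1 hj)
    rw [Nat.add_sub_cancel, Nat.cast_sub hj', abs_sub_comm]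
    have := le_abs_self (t - ((n : ℝ) - j))
    exact one_div_le_one_div_of_le (by positivity) (by linarith)
  have h2 : ∑ j ∈ Finset.range (n + 1), 1 / (1 + |((n + 1 + j : ℕ) : ℝ) - t|)
      ≤ ∑ j ∈ Finset.range (n + 1), 1 / ((j : ℝ) + 1) := by
    apply Finset.sum_le_sum
    intro j hj
    have := le_abs_self (((n + 1 + j : ℕ) : ℝ) - t)
    push_cast at this ⊢
    exact one_div_le_one_div_of_le (by positivity) (by linarith)
  have h3 := sum_range_inv_le (n + 1)
  have h4 : √((n + 1 : ℕ) : ℝ) ≤ 3 / 2 * √t := by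
    rw [Real.sqrt_le_left (by positivity), mul_pow, Real.sq_sqrt (by linarith)]
    push_cast
    linarith
  linarith

lemma sum_armCharge_error_le {k t : ℝ} {K N : ℕ} (hk : 1000 ≤ k) (hK : (K : ℝ) = k ^ 2)
    (h : K ≤ N) (ht : 1 ≤ t) :
    ∑ i ∈ Finset.Ico K N, armCharge k N i * (11 / (1 + |(i : ℝ) - t|)) + 1 / (4 * t ^ 2)
      ≤ min 1 (k ^ 2 / t) := by
  have hk0 : 0 < k := by linarith
  have ht0 : 0 < t := by linarith
  have hK2 : (1000000 : ℝ) ≤ K := by rw [hK]; nlinarith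
  have hKi : ∀ i ∈ Finset.Ico K N, (K : ℝ) ≤ i ∧ 1 ≤ i ∧ i < N := by
    intro i hi
    rw [Finset.mem_Ico] at hi
    have h1 : (K : ℝ) ≤ i := by exact_mod_cast hi.1
    refine ⟨h1, ?_, hi.2⟩
    have : (1 : ℝ) ≤ i := by linarith
    exact_mod_cast this
  have hmass : ∑ i ∈ Finset.Ico K N, armCharge k N i ≤ 1 := by
    rw [sum_armCharge hk0 hK h]
    have : 0 ≤ k ^ 2 / N := by positivity
    linarith
  rcases le_or_gt t (k ^ 2 / 2) with hc | hc
  · have h1 : ∑ i ∈ Finset.Ico K N, armCharge k N i * (11 / (1 + |(i : ℝ) - t|))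
        ≤ ∑ i ∈ Finset.Ico K N, armCharge k N i * (1 / 2) := by
      apply Finset.sum_le_sum
      intro i hi
      obtain ⟨hi1, hi2, hi3⟩ := hKi i hi
      apply mul_le_mul_of_nonneg_left _ (armCharge_nonneg hk0.le hi2)
      rw [div_le_div_iff₀ (by positivity) (by norm_num)]
      have := le_abs_self ((i : ℝ) - t)
      linarith
    rw [← Finset.sum_mul] at h1
    have h2 : 1 / (4 * t ^ 2) ≤ 1 / 4 := by
      apply one_div_le_one_div_of_le (by norm_num)
      nlinarith
    have h3 : 1 ≤ k ^ 2 / t := by rw [le_div_iff₀ ht0]; nlinarith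
    rw [min_eq_left h3]
    linarith
  · have hpt : ∀ i ∈ Finset.Ico K N, armCharge k N i * (11 / (1 + |(i : ℝ) - t|)) ≤
        armCharge k N i * (22 / t) + if |(i : ℝ) - t| < t / 2 then
          33 * k / (t * √t) * (1 / (1 + |(i : ℝ) - t|)) else 0 := by
      intro i hi
      obtain ⟨hi1, hi2, hi3⟩ := hKi i hi
      have hnn := armCharge_nonneg (N := N) hk0.le hi2
      split_ifs with hn
      · have hi4 : t / 2 ≤ i := by linarith [(abs_lt.1 hn).1]
        have h5 : armCharge k N i ≤ 3 * k / (t * √t) := by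
          refine (armCharge_le hk0.le hi2 hi3).trans ?_
          have h6 : 2 / 3 * √t ≤ √(i : ℝ) := by
            apply Real.le_sqrt_of_sq_le
            rw [mul_pow, Real.sq_sqrt ht0.le]
            linarith
          have hst : 0 < √t := Real.sqrt_pos.2 ht0
          have h7 : t * √t ≤ 3 * (i * √(i : ℝ)) := by
            have := mul_le_mul hi4 h6 (by positivity) (by positivity)
            linarith
          rw [div_le_div_iff₀ (by nlinarith [mul_pos ht0 hst]) (by positivity)]
          nlinarith
        have h8 : armCharge k N i * (11 / (1 + |(i : ℝ) - t|)) ≤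
            3 * k / (t * √t) * (11 / (1 + |(i : ℝ) - t|)) := by gcongr
        have h9 : 0 ≤ armCharge k N i * (22 / t) := by positivity
        have h10 : 3 * k / (t * √t) * (11 / (1 + |(i : ℝ) - t|)) =
            33 * k / (t * √t) * (1 / (1 + |(i : ℝ) - t|)) := by ring
        linarith
      · rw [add_zero]
        apply mul_le_mul_of_nonneg_left _ hnn
        rw [div_le_div_iff₀ (by positivity) ht0]
        linarith
    have h1 := Finset.sum_le_sum hpt
    rw [Finset.sum_add_distrib, ← Finset.sum_mul, ← Finset.sum_filter, ← Finset.mul_sum] at h1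
    have h2 := sum_near_le ht ((Finset.Ico K N).filter fun i => |(i : ℝ) - t| < t / 2)
      (fun i hi => (Finset.mem_filter.1 hi).2)
    have hst : 0 < √t := Real.sqrt_pos.2 ht0
    have h3 : 33 * k / (t * √t) * ∑ i ∈ Finset.Ico K N with |((i : ℕ) : ℝ) - t| < t / 2,
        1 / (1 + |(i : ℝ) - t|) ≤ 198 * k / t := by
      refine (mul_le_mul_of_nonneg_left h2 (by positivity)).trans (le_of_eq ?_)
      field_simp
      ring
    have h4 : (∑ i ∈ Finset.Ico K N, armCharge k N i) * (22 / t) ≤ 22 / t :=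
      mul_le_of_le_one_left (by positivity) hmass
    have h5 : 1 / (4 * t ^ 2) ≤ 1 / t := by
      apply one_div_le_one_div_of_le ht0
      nlinarith
    have h6 : k ^ 2 / 2 / t ≤ min 1 (k ^ 2 / t) := by
      apply le_min
      · rw [div_le_one ht0]; exact hc.le
      · gcongr; nlinarith
    have h7 : 22 / t + 198 * k / t + 1 / t ≤ k ^ 2 / 2 / t := by
      rw [← add_div, ← add_div]
      gcongr
      nlinarith
    linarith

/-- The potential of the charges on an arm nearly dominates that of a unit charge at its tip. -/
lemma neg_le_sum_armCharge_mul {k t β : ℝ} {K N : ℕ} (hk : 1000 ≤ k) (hK : (K : ℝ) = k ^ 2)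
    (h : K ≤ N) (ht : 1 ≤ t) (α d : ℕ → ℝ)
    (hd : ∀ i ∈ Finset.Ico K N, ∃ ρ : ℝ, (i : ℝ) ≤ ρ ∧ ρ ≤ i + 1 ∧ |ρ - t| ≤ d i)
    (hα : ∀ i ∈ Finset.Ico K N, Real.log (d i + 1) - 11 / (d i + 2) ≤ α i)
    (hβ : β ≤ Real.log t + 1 / (4 * t ^ 2)) :
    -((6 * k + 2 * k ^ 3) / √(N : ℝ)) ≤ ∑ i ∈ Finset.Ico K N, armCharge k N i * (α i - β) := by
  have hk0 : 0 < k := by linarith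
  have ht0 : 0 < t := by linarith
  have hKN : (K : ℝ) ≤ N := by exact_mod_cast h
  have hN0 : (1 : ℝ) ≤ N := by nlinarith
  have hsN : 0 < √(N : ℝ) := Real.sqrt_pos.2 (by linarith)
  set τ := √t with hτ
  have hττ : τ ^ 2 = t := Real.sq_sqrt ht0.le
  have hτ1 : 1 ≤ τ := Real.one_le_sqrt.2 ht
  have hτ0 : 0 < τ := by linarith
  have hpt : ∀ i ∈ Finset.Ico K N,
      k * (armPot N τ √((i : ℝ) + 1) - armPot N τ √(i : ℝ))
        - armCharge k N i * (11 / (1 + |(i : ℝ) - t|)) - armCharge k N i * (1 / (4 * t ^ 2))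
        ≤ armCharge k N i * (α i - β) := by
    intro i hi
    obtain ⟨ρ, hρ1, hρ2, hρd⟩ := hd i hi
    have hKi : (K : ℝ) ≤ i := by exact_mod_cast (Finset.mem_Ico.1 hi).1
    have hi0 : (1 : ℝ) ≤ i := by nlinarith
    have hi1 : 1 ≤ i := by exact_mod_cast hi0
    have hsi : 0 < √(i : ℝ) := Real.sqrt_pos.2 (by linarith)
    have hd0 : 0 ≤ d i := (abs_nonneg _).trans hρd
    have hsub := armPot_sub_le (N := N) (τ := τ) (a := √(i : ℝ)) (b := √((i : ℝ) + 1))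
      (c := Real.log (d i + 1) - Real.log t) (by linarith) hτ0 hsi
      (Real.sqrt_le_sqrt (by linarith)) (by
        intro u hu hne
        have hu0 : 0 < u := hsi.trans hu.1
        have hu1 : (i : ℝ) < u ^ 2 := (Real.sqrt_lt' hu0).1 hu.1
        have hu2 : u ^ 2 < (i : ℝ) + 1 := (Real.lt_sqrt hu0.le).1 hu.2
        rw [← Real.log_mul (sub_ne_zero.2 hne) (by linarith), ← hττ, Real.log_pow,
          ← Real.log_abs]
        push_cast
        apply sub_le_sub_right
        apply Real.log_le_log
        · exact abs_pos.2 (mul_ne_zero (sub_ne_zero.2 hne) (by linarith))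
        · rw [show (u - τ) * (u + τ) = u ^ 2 - t by rw [← hττ]; ring]
          have := abs_le.1 hρd
          rw [abs_le]
          constructor <;> linarith)
    have hch := armCharge_nonneg (N := N) hk0.le hi1
    have h1 := mul_le_mul_of_nonneg_left hsub hk0.le
    rw [← mul_assoc] at h1
    change _ ≤ armCharge k N i * _ at h1
    have h2 : 11 / (d i + 2) ≤ 11 / (1 + |(i : ℝ) - t|) := by
      have := abs_le.1 hρd
      have h4 : |(i : ℝ) - t| ≤ d i + 1 := by rw [abs_le]; constructor <;> linarith
      exact div_le_div_of_nonneg_left (by norm_num) (by positivity) (by linarith)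
    have h3 := hα i hi
    have h4 : Real.log (d i + 1) - Real.log t - 11 / (1 + |(i : ℝ) - t|) - 1 / (4 * t ^ 2)
        ≤ α i - β := by linarith
    have h5 := mul_le_mul_of_nonneg_left h4 hch
    linarith
  have hsum := Finset.sum_le_sum hpt
  have hs := Finset.sum_Ico_sub (hmn := h) (f := fun i => armPot N τ √(i : ℝ))
  simp only [Nat.cast_add, Nat.cast_one] at hs
  rw [Finset.sum_sub_distrib, Finset.sum_sub_distrib, ← Finset.mul_sum, hs, ← Finset.sum_mul] at hsum
  have herr := sum_armCharge_error_le (N := N) hk hK h ht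
  have hmass : ∑ i ∈ Finset.Ico K N, armCharge k N i ≤ 1 := by
    rw [sum_armCharge hk0 hK h]
    have : 0 ≤ k ^ 2 / N := by positivity
    linarith
  have hm2 : (∑ i ∈ Finset.Ico K N, armCharge k N i) * (1 / (4 * t ^ 2)) ≤ 1 / (4 * t ^ 2) :=
    mul_le_of_le_one_left (by positivity) hmass
  have hend := le_armPot_sqrt hτ0 hsN
  rw [Real.sq_sqrt (by linarith)] at hend
  have hstart := mul_armPot_le (N := N) (by linarith) hτ1 hk0
  rw [hττ] at hstart
  rw [hK, Real.sqrt_sq hk0.le, mul_sub] at hsum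
  have hend' := mul_le_mul_of_nonneg_left hend hk0.le
  have hNs : 2 * k ^ 3 / N ≤ 2 * k ^ 3 / √(N : ℝ) := by
    gcongr
    rw [Real.sqrt_le_left (by linarith)]
    nlinarith
  have e : (6 * k + 2 * k ^ 3) / √(N : ℝ) = k * (6 / √(N : ℝ)) + 2 * k ^ 3 / √(N : ℝ) := by ring
  rw [e]
  linarith

lemma hitP_nonneg {V : Type*} (nbr : V → Finset V) (A : Set V) (n : ℕ) (x y : V) :
    0 ≤ hitP nbr A n x y := by
  induction n generalizing x with
  | zero => unfold hitP; split_ifs <;> norm_num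
  | succ n ih =>
    unfold hitP
    split_ifs
    · norm_num
    · exact le_rfl
    · exact mul_nonneg (by positivity) (Finset.sum_nonneg fun z _ => ih z)

lemma hitP_mono {V : Type*} (nbr : V → Finset V) (A : Set V) (x y : V) :
    Monotone fun n => hitP nbr A n x y := by
  refine monotone_nat_of_le_succ fun n => ?_
  induction n generalizing x with
  | zero =>
    by_cases hx : x ∈ A
    · simp only [hitP, if_pos hx]
      split_ifs with h h' <;> first | exact le_rfl | exact zero_le_one | exact absurd h.2 h'
    · have h : hitP nbr A 0 x y = 0 := by simp [hitP, hx]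
      rw [h]
      exact hitP_nonneg nbr A 1 x y
  | succ n ih =>
    rw [hitP, hitP]
    split_ifs
    · exact le_rfl
    · exact le_rfl
    · exact mul_le_mul_of_nonneg_left (Finset.sum_le_sum fun z _ => ih z) (by positivity)

lemma sum_hitP_le_one {V : Type*} (nbr : V → Finset V) (A : Finset V) (n : ℕ) (x : V) :
    ∑ y ∈ A, hitP nbr (A : Set V) n x y ≤ 1 := by
  classical
  induction n generalizing x with
  | zero =>
    by_cases hx : x ∈ A
    · simp [hitP, hx]
    · simp [hitP, hx]
  | succ n ih =>
    by_cases hx : x ∈ A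
    · simp [hitP, hx]
    · simp only [hitP, Finset.mem_coe, hx, if_false]
      rw [← Finset.mul_sum, Finset.sum_comm]
      calc ((nbr x).card : ℝ)⁻¹ * ∑ z ∈ nbr x, ∑ y ∈ A, hitP nbr (A : Set V) n z y
          ≤ ((nbr x).card : ℝ)⁻¹ * ∑ z ∈ nbr x, 1 :=
            mul_le_mul_of_nonneg_left (Finset.sum_le_sum fun z _ => ih z) (by positivity)
        _ ≤ 1 := by
            rw [Finset.sum_const, nsmul_eq_mul, mul_one]
            exact inv_mul_le_one

lemma hitP_le_one {V : Type*} (nbr : V → Finset V) (A : Finset V) (n : ℕ) (x : V) {y : V}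
    (hy : y ∈ A) : hitP nbr (A : Set V) n x y ≤ 1 :=
  (Finset.single_le_sum (f := fun y => hitP nbr (A : Set V) n x y)
    (fun z _ => hitP_nonneg nbr _ n x z) hy).trans (sum_hitP_le_one nbr A n x)

lemma tendsto_hitP {V : Type*} (nbr : V → Finset V) (A : Finset V) (x : V) {y : V}
    (hy : y ∈ A) :
    Tendsto (fun n => hitP nbr (A : Set V) n x y) atTop (𝓝 (hitMeas nbr (A : Set V) x y)) := by
  refine tendsto_atTop_ciSup (hitP_mono nbr _ x y) ⟨1, ?_⟩
  rintro _ ⟨n, rfl⟩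
  exact hitP_le_one nbr A n x hy

lemma hitMeas_nonneg {V : Type*} (nbr : V → Finset V) (A : Set V) (x y : V) :
    0 ≤ hitMeas nbr A x y := Real.iSup_nonneg fun n => hitP_nonneg nbr A n x y

lemma sum_hitMeas_le_one {V : Type*} (nbr : V → Finset V) (A : Finset V) (x : V) :
    ∑ y ∈ A, hitMeas nbr (A : Set V) x y ≤ 1 :=
  le_of_tendsto' (tendsto_finsetSum A fun _ hy => tendsto_hitP nbr A x hy)
    fun n => sum_hitP_le_one nbr A n x

/-- A nonnegative function that is superharmonic off `A ∪ S` dominates the probability of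
entering `A` at `c` for walks that cannot enter `S` before `A`. -/
lemma hitP_mul_le {A S : Set (Fin 2 → ℤ)} {F : (Fin 2 → ℤ) → ℝ} (c : Fin 2 → ℤ)
    (hF : ∀ x, 0 ≤ F x) (hsup : ∀ x, x ∉ S → x ∉ A → ∑ z ∈ latNbrs x, F z ≤ 4 * F x)
    (hS : ∀ x, x ∉ S → x ∉ A → ∀ z ∈ latNbrs x, z ∉ S) (n : ℕ) {x : Fin 2 → ℤ} (hx : x ∉ S) :
    hitP latNbrs A n x c * F c ≤ F x := by
  induction n generalizing x with
  | zero =>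
    rw [hitP]
    split_ifs with h
    · rw [h.2, one_mul]
    · simpa using hF x
  | succ n ih =>
    rw [hitP]
    split_ifs with h h'
    · rw [h', one_mul]
    · simpa using hF x
    · rw [card_latNbrs, mul_assoc, Finset.sum_mul]
      have h1 : ∑ z ∈ latNbrs x, hitP latNbrs A n z c * F c ≤ ∑ z ∈ latNbrs x, F z :=
        Finset.sum_le_sum fun z hz => ih (hS x hx h z hz)
      have h2 := hsup x hx h
      push_cast
      linarith

lemma hitMeas_mul_le {A : Finset (Fin 2 → ℤ)} {S : Set (Fin 2 → ℤ)} {F : (Fin 2 → ℤ) → ℝ}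
    {c : Fin 2 → ℤ} (hc : c ∈ A)
    (hF : ∀ x, 0 ≤ F x) (hsup : ∀ x, x ∉ S → x ∉ A → ∑ z ∈ latNbrs x, F z ≤ 4 * F x)
    (hS : ∀ x, x ∉ S → x ∉ A → ∀ z ∈ latNbrs x, z ∉ S) {x : Fin 2 → ℤ} (hx : x ∉ S) :
    hitMeas latNbrs (A : Set (Fin 2 → ℤ)) x c * F c ≤ F x :=
  le_of_tendsto' ((tendsto_hitP latNbrs A x hc).mul_const (F c)) fun n =>
    hitP_mul_le c hF (by simpa using hsup) (by simpa using hS) n hx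

lemma finite_eunorm_sub_le (c : Fin 2 → ℤ) (R : ℝ) :
    {x : Fin 2 → ℤ | eunorm (x - c) ≤ R}.Finite := by
  set m : ℤ := ⌈|R|⌉
  refine (Set.finite_Icc (c - fun _ => m) (c + fun _ => m)).subset fun x hx => ?_
  have h0 : eunorm (x - c) ≤ |R| := le_trans hx (le_abs_self R)
  have h2 := sq_eunorm (x - c)
  have h3 : |R| ≤ m := Int.le_ceil _
  have h4 : eunorm (x - c) ≤ m := h0.trans h3
  have hm : (0 : ℝ) ≤ m := (abs_nonneg R).trans h3
  have hb : ∀ i, |((x - c) i : ℝ)| ≤ m := by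
    intro i
    refine abs_le_of_sq_le_sq ?_ hm
    have h5 := eunorm_nonneg (x - c)
    have h6 : eunorm (x - c) ^ 2 ≤ (m : ℝ) ^ 2 := pow_le_pow_left₀ h5 h4 2
    fin_cases i <;> simp only [Fin.zero_eta, Fin.mk_one] <;>
      nlinarith [sq_nonneg ((x - c) 0 : ℝ), sq_nonneg ((x - c) 1 : ℝ)]
  have hb' : ∀ i, |(x - c) i| ≤ m := fun i => by exact_mod_cast hb i
  constructor
  · intro i
    have := (abs_le.1 (hb' i)).1
    simp only [Pi.sub_apply] at this ⊢
    linarith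
  · intro i
    have := (abs_le.1 (hb' i)).2
    simp only [Pi.sub_apply, Pi.add_apply] at this ⊢
    linarith

lemma not_mem_of_mem_latNbrs {E : Finset (Fin 2 → ℤ)} {x z : Fin 2 → ℤ} (hx : x ∉ E)
    (hx' : x ∉ bdryF latNbrs E) (hz : z ∈ latNbrs x) : z ∉ E := by
  intro hzE
  refine hx' ?_
  rw [bdryF, Finset.mem_sdiff, Finset.mem_biUnion]
  exact ⟨⟨z, hzE, mem_latNbrs_comm hz⟩, hx⟩

/-- The potential of a charge spread along an arm `b` emanating near `c`, normalised so as to be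
nonnegative; it is superharmonic off the arm. -/
noncomputable def armFun (N : ℕ) (b : ℕ → Fin 2 → ℤ) (c y : Fin 2 → ℤ) : ℝ :=
  2000006000 / √(N : ℝ) + ∑ i ∈ Finset.Ico 1000000 N,
    armCharge 1000 N i * (superLog (y - b i) - subLog (y - c))

lemma sum_armCharge_eq {N : ℕ} (hN : 1000000 ≤ N) :
    ∑ i ∈ Finset.Ico 1000000 N, armCharge 1000 N i = 1 - 1000000 / N := by
  rw [sum_armCharge (by norm_num) (by norm_num) hN]
  norm_num

lemma armCharge_nonneg_of_mem {N i : ℕ} (hi : i ∈ Finset.Ico 1000000 N) :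
    0 ≤ armCharge 1000 N i := by
  have := (Finset.mem_Ico.1 hi).1
  exact armCharge_nonneg (by norm_num) (by omega)

lemma armFun_nonneg {N : ℕ} (hN : 1000000 ≤ N) {b : ℕ → Fin 2 → ℤ} {c y : Fin 2 → ℤ}
    (hb : ∀ i ∈ Finset.Ico 1000000 N, (i : ℝ) ≤ eunorm (b i - c) ∧ eunorm (b i - c) ≤ i + 1)
    (hy : y ≠ c) : 0 ≤ armFun N b c y := by
  have h := neg_le_sum_armCharge_mul (k := 1000) (K := 1000000) (N := N) le_rfl (by norm_num) hN
    (one_le_eunorm (sub_ne_zero.2 hy)) (fun i => superLog (y - b i)) (fun i => eunorm (y - b i))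
    (fun i hi => ⟨eunorm (b i - c), (hb i hi).1, (hb i hi).2, ?_⟩)
    (fun i _ => log_sub_le_superLog _) (subLog_le (sub_ne_zero.2 hy))
  · norm_num at h
    unfold armFun
    linarith
  · rw [abs_sub_le_iff]
    constructor
    · have := eunorm_sub_le (b i) y c
      rw [eunorm_sub_comm (b i) y] at this
      linarith
    · have := eunorm_sub_le y (b i) c
      linarith

lemma superLogArg_of_ne {x : Fin 2 → ℤ} (hx : x ≠ 0) : superLogArg x = eunorm x ^ 2 - 1 / 2 := by
  rw [superLogArg, if_neg hx]

lemma le_armFun_center {N : ℕ} (hN : 2000000 ≤ N) {b : ℕ → Fin 2 → ℤ} {c : Fin 2 → ℤ}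
    (hb : ∀ i ∈ Finset.Ico 1000000 N, (i : ℝ) ≤ eunorm (b i - c)) :
    1 / 6 ≤ armFun N b c c := by
  have hN' : (2000000 : ℝ) ≤ N := by exact_mod_cast hN
  have h1 : ∀ i ∈ Finset.Ico 1000000 N, armCharge 1000 N i * (0.34 : ℝ) ≤
      armCharge 1000 N i * (superLog (c - b i) - subLog (c - c)) := by
    intro i hi
    refine mul_le_mul_of_nonneg_left ?_ (armCharge_nonneg_of_mem hi)
    have h2 : (1000000 : ℝ) ≤ i := by exact_mod_cast (Finset.mem_Ico.1 hi).1
    have h3 := hb i hi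
    rw [eunorm_sub_comm] at h3
    have h4 : c - b i ≠ 0 := by
      intro h0
      rw [h0, eunorm_zero] at h3
      linarith
    have h5 : 0 ≤ superLog (c - b i) := by
      unfold superLog
      rw [superLogArg_of_ne h4]
      have : 0 ≤ Real.log (eunorm (c - b i) ^ 2 - 1 / 2) := Real.log_nonneg (by nlinarith)
      linarith
    have h6 : subLog (c - c) = - Real.log 2 / 2 := by
      rw [sub_self, subLog, eunorm_zero, show (0 : ℝ) ^ 2 + 1 / 2 = 2⁻¹ by norm_num, Real.log_inv]
    rw [h6]
    have := Real.log_two_gt_d9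
    linarith
  have h2 := Finset.sum_le_sum h1
  rw [← Finset.sum_mul, sum_armCharge_eq (by omega)] at h2
  have h3 : (1000000 : ℝ) / N ≤ 1 / 2 := by
    rw [div_le_div_iff₀ (by linarith) (by norm_num)]
    linarith
  have h4 : 0 ≤ 2000006000 / √(N : ℝ) := by positivity
  unfold armFun
  linarith

lemma sum_armFun_le {N : ℕ} {b : ℕ → Fin 2 → ℤ} {c x : Fin 2 → ℤ}
    (hx : ∀ i ∈ Finset.Ico 1000000 N, x ≠ b i) :
    ∑ z ∈ latNbrs x, armFun N b c z ≤ 4 * armFun N b c x := by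
  unfold armFun
  rw [Finset.sum_add_distrib, Finset.sum_const, card_latNbrs, Finset.sum_comm, mul_add,
    Finset.mul_sum, nsmul_eq_mul]
  push_cast
  refine add_le_add le_rfl (Finset.sum_le_sum fun i hi => ?_)
  rw [← Finset.mul_sum, Finset.sum_sub_distrib]
  have hshift : ∀ (f : (Fin 2 → ℤ) → ℝ) (a : Fin 2 → ℤ),
      ∑ z ∈ latNbrs x, f (z - a) = ∑ z ∈ latNbrs (x - a), f z := by
    intro f a
    rw [sum_latNbrs, sum_latNbrs]
    simp only [add_sub_right_comm]
  rw [hshift superLog, hshift subLog]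
  have h1 := average_superLog_le (sub_ne_zero.2 (hx i hi))
  have h2 := subLog_le_average (x - c)
  have h3 := mul_le_mul_of_nonneg_left (show ∑ z ∈ latNbrs (x - b i), superLog z -
    ∑ z ∈ latNbrs (x - c), subLog z ≤ 4 * (superLog (x - b i) - subLog (x - c)) by linarith)
    (armCharge_nonneg_of_mem hi)
  linarith

lemma superLog_sub_subLog_le {x b c : Fin 2 → ℤ} {D : ℝ} (hD : eunorm (b - c) ≤ D)
    (hx : D < eunorm (x - c)) : superLog (x - b) - subLog (x - c) ≤ D / eunorm (x - c) := by
  set t := eunorm (x - c)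
  have hD0 : 0 ≤ D := (eunorm_nonneg _).trans hD
  have ht : 0 < t := by linarith
  have hxb : x - b ≠ 0 := by
    intro h
    rw [sub_eq_zero] at h
    subst h
    linarith
  have h1 := one_le_eunorm hxb
  have h2 : eunorm (x - b) ≤ t + D := by
    have := eunorm_sub_le x c b
    rw [eunorm_sub_comm c b] at this
    linarith
  have h3 : superLog (x - b) ≤ Real.log (t + D) := by
    unfold superLog
    rw [superLogArg_of_ne hxb]
    have : Real.log (eunorm (x - b) ^ 2 - 1 / 2) ≤ Real.log ((t + D) ^ 2) :=
      Real.log_le_log (by nlinarith) (by nlinarith)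
    rw [Real.log_pow] at this
    push_cast at this
    linarith
  have h4 : Real.log t ≤ subLog (x - c) := by
    unfold subLog
    have : Real.log (t ^ 2) ≤ Real.log (t ^ 2 + 1 / 2) := Real.log_le_log (by positivity) (by linarith)
    rw [Real.log_pow] at this
    push_cast at this
    linarith
  have h5 := Real.log_le_sub_one_of_pos (show 0 < (t + D) / t by positivity)
  rw [Real.log_div (by positivity) (by positivity)] at h5
  have h6 : (t + D) / t - 1 = D / t := by field_simp; ring
  linarith

lemma eventually_armFun_le {N : ℕ} (hN : 1000000 ≤ N) {b : ℕ → Fin 2 → ℤ} {c : Fin 2 → ℤ}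
    (hb : ∀ i ∈ Finset.Ico 1000000 N, eunorm (b i - c) ≤ i + 1) :
    ∀ᶠ x in cofinite, armFun N b c x ≤ 4000012000 / √(N : ℝ) := by
  have hN' : (1000000 : ℝ) ≤ N := by exact_mod_cast hN
  set ε : ℝ := 2000006000 / √(N : ℝ) with hε
  have hε0 : 0 < ε := by
    have : 0 < √(N : ℝ) := Real.sqrt_pos.2 (by linarith)
    positivity
  have hfin := finite_eunorm_sub_le c (max N (N / ε))
  filter_upwards [hfin.compl_mem_cofinite] with x hx
  simp only [Set.mem_compl_iff, Set.mem_ofPred_eq, not_le, max_lt_iff] at hx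
  have h1 : ∀ i ∈ Finset.Ico 1000000 N, armCharge 1000 N i *
      (superLog (x - b i) - subLog (x - c)) ≤ armCharge 1000 N i * ε := by
    intro i hi
    refine mul_le_mul_of_nonneg_left ?_ (armCharge_nonneg_of_mem hi)
    have h2 : (i : ℝ) + 1 ≤ N := by exact_mod_cast (Finset.mem_Ico.1 hi).2
    refine (superLog_sub_subLog_le ((hb i hi).trans h2) hx.1).trans ?_
    have h3 := hx.2
    rw [div_lt_iff₀ hε0] at h3
    rw [div_le_iff₀ (by linarith)]
    linarith
  have h2 := Finset.sum_le_sum h1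
  rw [← Finset.sum_mul, sum_armCharge_eq hN] at h2
  have h3 : 0 ≤ (1000000 : ℝ) / N := by positivity
  have h4 : 4000012000 / √(N : ℝ) = 2 * ε := by rw [hε]; ring
  rw [h4]
  unfold armFun
  nlinarith

lemma harmonic_le_of_arm {E : Finset (Fin 2 → ℤ)} {c : Fin 2 → ℤ} (hc : c ∈ bdryF latNbrs E)
    {N : ℕ} (hN : 2000000 ≤ N) {b : ℕ → Fin 2 → ℤ}
    (hb : ∀ i ∈ Finset.Ico 1000000 N,
      b i ∈ E ∧ (i : ℝ) ≤ eunorm (b i - c) ∧ eunorm (b i - c) ≤ i + 1)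
    {m : ℝ} (hm : Tendsto (fun x => hitMeas latNbrs (bdryF latNbrs E : Set (Fin 2 → ℤ)) x c)
      cofinite (𝓝 m)) : m ≤ 24000072000 / √(N : ℝ) := by
  have hc6 := le_armFun_center hN (fun i hi => (hb i hi).2.1)
  have hF : ∀ x, 0 ≤ armFun N b c x := by
    intro x
    by_cases hx : x = c
    · subst hx; linarith
    · exact armFun_nonneg (by omega) (fun i hi => (hb i hi).2) hx
  refine le_of_tendsto hm ?_
  filter_upwards [eventually_armFun_le (by omega) (fun i hi => (hb i hi).2.2),
    E.finite_toSet.compl_mem_cofinite] with x hx hxE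
  have h1 := hitMeas_mul_le (S := (E : Set (Fin 2 → ℤ))) hc hF
    (fun x hx _ => sum_armFun_le fun i hi h => hx (h ▸ (hb i hi).1))
    (fun x hx hx' z hz => not_mem_of_mem_latNbrs hx hx' hz) hxE
  have h2 := hitMeas_nonneg latNbrs (bdryF latNbrs E : Set (Fin 2 → ℤ)) x c
  have h3 : 24000072000 / √(N : ℝ) = 6 * (4000012000 / √(N : ℝ)) := by ring
  rw [h3]
  nlinarith

/-- Possible histories of the growth process, latest addition first. -/
inductive IsHistory : List (Fin 2 → ℤ) → Prop
  | start : IsHistory [0]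
  | cons {y : Fin 2 → ℤ} {h : List (Fin 2 → ℤ)} (hh : IsHistory h)
      (hy : y ∈ bdryF latNbrs h.toFinset) : IsHistory (y :: h)

lemma exists_mem_latNbrs_of_mem_bdryF {h : List (Fin 2 → ℤ)} {y : Fin 2 → ℤ}
    (hy : y ∈ bdryF latNbrs h.toFinset) : ∃ z ∈ h, z ∈ latNbrs y := by
  rw [bdryF, Finset.mem_sdiff, Finset.mem_biUnion] at hy
  obtain ⟨⟨z, hz, hyz⟩, -⟩ := hy
  exact ⟨z, List.mem_toFinset.1 hz, mem_latNbrs_comm hyz⟩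

namespace IsHistory

lemma zero_mem {h : List (Fin 2 → ℤ)} (hh : IsHistory h) : 0 ∈ h := by
  induction hh with
  | start => simp
  | cons _ _ ih => exact List.mem_cons_of_mem _ ih

lemma exists_eunorm_sub_mem {h : List (Fin 2 → ℤ)} (hh : IsHistory h) (c : Fin 2 → ℤ) {r : ℝ}
    {u v : Fin 2 → ℤ} (hu : u ∈ h) (hv : v ∈ h) (hur : eunorm (u - c) ≤ r)
    (hvr : r ≤ eunorm (v - c)) : ∃ b ∈ h, r ≤ eunorm (b - c) ∧ eunorm (b - c) ≤ r + 1 := by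
  induction hh generalizing u v with
  | start =>
    rw [List.mem_singleton] at hu hv
    subst hu hv
    exact ⟨0, by simp, hvr, by linarith⟩
  | @cons y h hh hy ih =>
    obtain ⟨z, hz, hzy⟩ := exists_mem_latNbrs_of_mem_bdryF hy
    have h1 := eunorm_sub_of_mem_latNbrs hzy
    have h2 := eunorm_sub_le z y c
    have h3 := eunorm_sub_le y z c
    rw [eunorm_sub_comm y z] at h3
    have lift : (∃ b ∈ h, r ≤ eunorm (b - c) ∧ eunorm (b - c) ≤ r + 1) →
        ∃ b ∈ y :: h, r ≤ eunorm (b - c) ∧ eunorm (b - c) ≤ r + 1 :=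
      fun ⟨b, hb, hb'⟩ => ⟨b, List.mem_cons_of_mem _ hb, hb'⟩
    rcases List.mem_cons.1 hu with rfl | huh <;> rcases List.mem_cons.1 hv with rfl | hvh
    · exact ⟨v, List.mem_cons_self, hvr, by linarith⟩
    · rcases le_total (eunorm (z - c)) r with h4 | h4
      · exact lift (ih hz hvh h4 hvr)
      · exact ⟨z, List.mem_cons_of_mem _ hz, h4, by linarith⟩
    · rcases le_total r (eunorm (z - c)) with h4 | h4
      · exact lift (ih huh hz hur h4)
      · exact ⟨v, List.mem_cons_self, hvr, by linarith⟩
    · exact lift (ih huh hvh hur hvr)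

end IsHistory

/-- A discrete Beurling estimate: the harmonic measure of a point of the boundary of a cluster
of radius at least `L` is at most of order `L ^ (-1/2)`. -/
lemma IsHistory.harmonic_le {h : List (Fin 2 → ℤ)} (hh : IsHistory h) {z : Fin 2 → ℤ} (hz : z ∈ h)
    {L : ℝ} (hL : 0 < L) (hzL : L ≤ eunorm z) {c : Fin 2 → ℤ}
    (hc : c ∈ bdryF latNbrs h.toFinset) {m : ℝ}
    (hm : Tendsto (fun x => hitMeas latNbrs (bdryF latNbrs h.toFinset : Set (Fin 2 → ℤ)) x c)
      cofinite (𝓝 m)) : m ≤ 48000144000 / √L := by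
  have hsL : 0 < √L := Real.sqrt_pos.2 hL
  rcases lt_or_ge L 4000000 with hL' | hL'
  · have h1 : m ≤ 1 := le_of_tendsto' hm fun x =>
      (Finset.single_le_sum (f := fun y => hitMeas latNbrs _ x y)
        (fun y _ => hitMeas_nonneg latNbrs _ x y) hc).trans (sum_hitMeas_le_one latNbrs _ x)
    have h2 : √L ≤ 2000 := by
      rw [Real.sqrt_le_left (by norm_num)]
      linarith
    refine h1.trans ?_
    rw [le_div_iff₀ hsL]
    linarith
  · set N := ⌊L / 2⌋₊ with hN
    have hNL : (N : ℝ) ≤ L / 2 := Nat.floor_le (by linarith)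
    have hLN : L / 2 < N + 1 := Nat.lt_floor_add_one _
    have hN2 : 2000000 ≤ N := Nat.le_floor (by push_cast; linarith)
    obtain ⟨u, hu, huc⟩ := exists_mem_latNbrs_of_mem_bdryF hc
    have hu1 := eunorm_sub_of_mem_latNbrs huc
    have hfar : ∃ v ∈ h, L / 2 ≤ eunorm (v - c) := by
      by_contra! hcon
      have h1 := hcon z hz
      have h2 := hcon 0 hh.zero_mem
      have h3 := eunorm_sub_le z c 0
      rw [eunorm_sub_comm c 0, sub_zero] at h3
      linarith
    obtain ⟨v, hv, hvL⟩ := hfar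
    have hb : ∀ i : ℕ, ∃ b, i ∈ Finset.Ico 1000000 N →
        b ∈ h.toFinset ∧ (i : ℝ) ≤ eunorm (b - c) ∧ eunorm (b - c) ≤ i + 1 := by
      intro i
      by_cases hi : i ∈ Finset.Ico 1000000 N
      · have h1 : (1000000 : ℝ) ≤ i := by exact_mod_cast (Finset.mem_Ico.1 hi).1
        have h2 : (i : ℝ) ≤ N := by exact_mod_cast (Finset.mem_Ico.1 hi).2.le
        obtain ⟨b, hb, hb'⟩ := hh.exists_eunorm_sub_mem c hu hv (r := i)
          (by linarith) (by linarith)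
        exact ⟨b, fun _ => ⟨List.mem_toFinset.2 hb, hb'⟩⟩
      · exact ⟨0, fun h => absurd h hi⟩
    choose b hb using hb
    refine (harmonic_le_of_arm hc hN2 hb hm).trans ?_
    have h4 : √L / 2 ≤ √(N : ℝ) := by
      apply Real.le_sqrt_of_sq_le
      rw [div_pow, Real.sq_sqrt hL.le]
      linarith
    rw [div_le_div_iff₀ (by linarith) hsL]
    linarith

/-- Expectation of a function of the history after `n` steps, for transition weights `w`. -/
noncomputable def histExp (w : List (Fin 2 → ℤ) → (Fin 2 → ℤ) → ENNReal) :
    ℕ → (List (Fin 2 → ℤ) → ENNReal) → ENNReal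
  | 0, f => f [0]
  | n + 1, f => histExp w n fun h => ∑ y ∈ bdryF latNbrs h.toFinset, w h y * f (y :: h)

lemma histExp_mono (w : List (Fin 2 → ℤ) → (Fin 2 → ℤ) → ENNReal) (n : ℕ)
    {f g : List (Fin 2 → ℤ) → ENNReal} (hfg : ∀ h, IsHistory h → f h ≤ g h) :
    histExp w n f ≤ histExp w n g := by
  induction n generalizing f g with
  | zero => exact hfg _ .start
  | succ n ih =>
    exact ih fun h hh => Finset.sum_le_sum fun y hy =>
      mul_le_mul_right (hfg _ (.cons hh hy)) _

lemma histExp_add (w : List (Fin 2 → ℤ) → (Fin 2 → ℤ) → ENNReal) (n : ℕ)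
    (f g : List (Fin 2 → ℤ) → ENNReal) :
    histExp w n (fun h => f h + g h) = histExp w n f + histExp w n g := by
  induction n generalizing f g with
  | zero => rfl
  | succ n ih =>
    simp only [histExp, mul_add, Finset.sum_add_distrib]
    exact ih _ _

lemma histExp_const_mul (w : List (Fin 2 → ℤ) → (Fin 2 → ℤ) → ENNReal) (n : ℕ) (a : ENNReal)
    (f : List (Fin 2 → ℤ) → ENNReal) :
    histExp w n (fun h => a * f h) = a * histExp w n f := by
  induction n generalizing f with
  | zero => rfl
  | succ n ih =>
    simp only [histExp, mul_left_comm, ← Finset.mul_sum]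
    exact ih _

lemma histExp_one_le {w : List (Fin 2 → ℤ) → (Fin 2 → ℤ) → ENNReal}
    (hw : ∀ h, IsHistory h → ∑ y ∈ bdryF latNbrs h.toFinset, w h y ≤ 1) (n : ℕ) :
    histExp w n (fun _ => 1) ≤ 1 := by
  induction n with
  | zero => exact le_rfl
  | succ n ih =>
    refine (histExp_mono w n fun h hh => ?_).trans ih
    simpa using hw h hh

/-- The number of nearest neighbour chains of `j` steps ending at `x` whose vertices were added
to the cluster in chronological order, the first one at distance at least `L` from the origin. -/
noncomputable def chainCount (L : ℝ) : List (Fin 2 → ℤ) → ℕ → (Fin 2 → ℤ) → ENNReal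
  | [], _, _ => 0
  | y :: h, 0, x => chainCount L h 0 x + Set.indicator {z | z = y ∧ L ≤ eunorm y} 1 x
  | y :: h, j + 1, x => chainCount L h (j + 1) x +
      Set.indicator {y} (fun _ => ∑ z ∈ latNbrs y, chainCount L h j z) x

lemma exists_le_eunorm_of_chainCount_ne_zero {L : ℝ} {h : List (Fin 2 → ℤ)} {j : ℕ}
    {x : Fin 2 → ℤ} (hx : chainCount L h j x ≠ 0) : ∃ z ∈ h, L ≤ eunorm z := by
  induction h generalizing j x with
  | nil => simp [chainCount] at hx
  | cons y h ih =>
    have lift : (∃ z ∈ h, L ≤ eunorm z) → ∃ z ∈ y :: h, L ≤ eunorm z :=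
      fun ⟨z, hz, hz'⟩ => ⟨z, List.mem_cons_of_mem _ hz, hz'⟩
    cases j with
    | zero =>
      rw [chainCount] at hx
      by_cases h1 : chainCount L h 0 x = 0
      · rw [h1, zero_add] at hx
        exact ⟨y, List.mem_cons_self, (Set.mem_of_indicator_ne_zero hx).2⟩
      · exact lift (ih h1)
    | succ j =>
      rw [chainCount] at hx
      by_cases h1 : chainCount L h (j + 1) x = 0
      · rw [h1, zero_add] at hx
        rw [Set.indicator_of_mem (Set.mem_of_indicator_ne_zero hx)] at hx
        obtain ⟨z, -, hz⟩ := Finset.exists_ne_zero_of_sum_ne_zero hx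
        exact lift (ih hz)
      · exact lift (ih h1)

lemma IsHistory.one_le_chainCount {L : ℝ} (hL : 0 < L) {h : List (Fin 2 → ℤ)} (hh : IsHistory h)
    {j : ℕ} {x : Fin 2 → ℤ} (hx : x ∈ h) (hxL : L + j ≤ eunorm x) : 1 ≤ chainCount L h j x := by
  induction hh generalizing j x with
  | start =>
    rw [List.mem_singleton.1 hx, eunorm_zero] at hxL
    have : (0 : ℝ) ≤ j := by positivity
    linarith
  | @cons y h hh hy ih =>
    rcases List.mem_cons.1 hx with rfl | hx
    · cases j with
      | zero =>
        rw [chainCount, Set.indicator_of_mem (show x ∈ {z | z = x ∧ L ≤ eunorm x} from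
          ⟨rfl, by simpa using hxL⟩)]
        exact le_add_self
      | succ j =>
        obtain ⟨z, hz, hzy⟩ := exists_mem_latNbrs_of_mem_bdryF hy
        have h1 := eunorm_sub_of_mem_latNbrs hzy
        have h2 := eunorm_sub_le x z 0
        rw [eunorm_sub_comm x z, sub_zero, sub_zero] at h2
        push_cast at hxL
        rw [chainCount, Set.indicator_of_mem (Set.mem_singleton x)]
        exact ((ih hz (by linarith)).trans (Finset.single_le_sum (f := fun z => chainCount L h j z)
          (fun _ _ => zero_le) hzy)).trans le_add_self
    · refine (ih hx hxL).trans ?_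
      cases j <;> exact le_self_add

lemma tsum_indicator_singleton_le {ι : Type*} (s : Set ι) (y : ι) (hs : s ⊆ {y}) (a : ENNReal) :
    ∑' x, s.indicator (fun _ => a) x ≤ a := by
  rw [tsum_eq_single y fun x hx => Set.indicator_of_notMem (fun h => hx (hs h)) _]
  exact Set.indicator_le_self' (fun _ _ => zero_le) y

lemma tsum_chainCount_zero_cons_le (L : ℝ) (y : Fin 2 → ℤ) (h : List (Fin 2 → ℤ)) :
    ∑' x, chainCount L (y :: h) 0 x ≤ ∑' x, chainCount L h 0 x + 1 := by
  simp only [chainCount]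
  rw [ENNReal.tsum_add]
  exact add_le_add le_rfl (tsum_indicator_singleton_le _ y (fun z hz => hz.1) 1)

lemma tsum_chainCount_succ_cons_le (L : ℝ) (j : ℕ) (y : Fin 2 → ℤ) (h : List (Fin 2 → ℤ)) :
    ∑' x, chainCount L (y :: h) (j + 1) x ≤
      ∑' x, chainCount L h (j + 1) x + ∑ z ∈ latNbrs y, chainCount L h j z := by
  simp only [chainCount]
  rw [ENNReal.tsum_add]
  exact add_le_add le_rfl (tsum_indicator_singleton_le _ y subset_rfl _)

lemma sum_sum_latNbrs_le (s : Finset (Fin 2 → ℤ)) (f : (Fin 2 → ℤ) → ENNReal) :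
    ∑ y ∈ s, ∑ z ∈ latNbrs y, f z ≤ 4 * ∑' z, f z := by
  have hshift : ∀ a : Fin 2 → ℤ, ∑ y ∈ s, f (y + a) ≤ ∑' z, f z := by
    intro a
    rw [← (Equiv.addRight a).tsum_eq f]
    exact ENNReal.sum_le_tsum (f := fun y => f (y + a)) s
  simp only [sum_latNbrs, Finset.sum_add_distrib]
  calc _ ≤ ∑' z, f z + (∑' z, f z + (∑' z, f z + ∑' z, f z)) := by gcongr <;> apply hshift
    _ = 4 * ∑' z, f z := by ring

lemma histExp_tsum_chainCount_le {w : List (Fin 2 → ℤ) → (Fin 2 → ℤ) → ENNReal} {L : ℝ}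
    (hL : 0 < L) {p : ENNReal}
    (hw : ∀ h, IsHistory h → ∑ y ∈ bdryF latNbrs h.toFinset, w h y ≤ 1)
    (hp : ∀ h, IsHistory h → (∃ z ∈ h, L ≤ eunorm z) →
      ∀ y ∈ bdryF latNbrs h.toFinset, w h y ≤ p) (n j : ℕ) :
    histExp w n (fun h => ∑' x, chainCount L h j x) ≤ (n + 1) * n.choose j * (4 * p) ^ j := by
  induction n generalizing j with
  | zero =>
    have h0 : ∀ x, chainCount L [0] j x = 0 := by
      intro x
      cases j with
      | zero =>
        rw [chainCount, chainCount, zero_add]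
        refine Set.indicator_of_notMem (fun h => ?_) _
        rw [eunorm_zero] at h
        exact absurd h.2 (not_le.2 hL)
      | succ j => simp [chainCount]
    simp [histExp, h0]
  | succ n ih =>
    rw [histExp]
    cases j with
    | zero =>
      have h1 : histExp w n (fun h => ∑ y ∈ bdryF latNbrs h.toFinset,
          w h y * ∑' x, chainCount L (y :: h) 0 x) ≤
          histExp w n (fun h => (∑' x, chainCount L h 0 x) + 1) := by
        refine histExp_mono w n fun h hh => ?_
        calc _ ≤ ∑ y ∈ bdryF latNbrs h.toFinset, w h y * (∑' x, chainCount L h 0 x + 1) :=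
              Finset.sum_le_sum fun y _ => mul_le_mul_right (tsum_chainCount_zero_cons_le L y h) _
          _ = (∑ y ∈ bdryF latNbrs h.toFinset, w h y) * (∑' x, chainCount L h 0 x + 1) := by
              rw [Finset.sum_mul]
          _ ≤ 1 * (∑' x, chainCount L h 0 x + 1) := mul_le_mul_left (hw h hh) _
          _ = _ := one_mul _
      refine h1.trans ?_
      rw [histExp_add]
      have h2 := add_le_add (ih 0) (histExp_one_le hw n)
      simpa using h2
    | succ j =>
      have h1 : histExp w n (fun h => ∑ y ∈ bdryF latNbrs h.toFinset,
          w h y * ∑' x, chainCount L (y :: h) (j + 1) x) ≤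
          histExp w n (fun h => (∑' x, chainCount L h (j + 1) x) +
            (4 * p) * ∑' x, chainCount L h j x) := by
        refine histExp_mono w n fun h hh => ?_
        have hpz : ∀ y ∈ bdryF latNbrs h.toFinset, w h y * ∑ z ∈ latNbrs y, chainCount L h j z ≤
            p * ∑ z ∈ latNbrs y, chainCount L h j z := by
          intro y hy
          by_cases h0 : ∑ z ∈ latNbrs y, chainCount L h j z = 0
          · simp [h0]
          · obtain ⟨z, -, hz⟩ := Finset.exists_ne_zero_of_sum_ne_zero h0
            exact mul_le_mul_left
              (hp h hh (exists_le_eunorm_of_chainCount_ne_zero hz) y hy) _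
        calc _ ≤ ∑ y ∈ bdryF latNbrs h.toFinset, w h y * (∑' x, chainCount L h (j + 1) x +
                ∑ z ∈ latNbrs y, chainCount L h j z) :=
              Finset.sum_le_sum fun y _ => mul_le_mul_right (tsum_chainCount_succ_cons_le L j y h) _
          _ = (∑ y ∈ bdryF latNbrs h.toFinset, w h y) * (∑' x, chainCount L h (j + 1) x) +
                ∑ y ∈ bdryF latNbrs h.toFinset, w h y * ∑ z ∈ latNbrs y, chainCount L h j z := by
              simp only [mul_add, Finset.sum_add_distrib, Finset.sum_mul]
          _ ≤ 1 * (∑' x, chainCount L h (j + 1) x) +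
                ∑ y ∈ bdryF latNbrs h.toFinset, p * ∑ z ∈ latNbrs y, chainCount L h j z :=
              add_le_add (mul_le_mul_left (hw h hh) _) (Finset.sum_le_sum hpz)
          _ ≤ _ := by
              rw [one_mul, ← Finset.mul_sum, mul_comm 4 p, mul_assoc]
              exact add_le_add le_rfl (mul_le_mul_right (sum_sum_latNbrs_le _ _) _)
      refine h1.trans ?_
      rw [histExp_add, histExp_const_mul]
      refine (add_le_add (ih (j + 1)) (mul_le_mul_right (ih j) _)).trans ?_
      rw [Nat.choose_succ_succ]
      push_cast
      calc _ = ((n : ENNReal) + 1) * (n.choose j + n.choose (j + 1)) * (4 * p) ^ (j + 1) := by ring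
        _ ≤ _ := by gcongr; exact le_self_add

lemma tsum_measure_mul_le_histExp {Ω : Type*} [MeasurableSpace Ω] (P : Measure Ω)
    [IsProbabilityMeasure P] {E : ℕ → Ω → Finset (Fin 2 → ℤ)} {Y : ℕ → Ω → (Fin 2 → ℤ)}
    {W : Finset (Fin 2 → ℤ) → (Fin 2 → ℤ) → ENNReal}
    (h0 : ∀ ω, E 0 ω = {0})
    (hstep : ∀ n ω, E (n + 1) ω = insert (Y (n + 1) ω) (E n ω))
    (hbd : ∀ n ω, Y (n + 1) ω ∈ bdryF latNbrs (E n ω))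
    (hlaw : ∀ (n : ℕ) (A : Finset (Fin 2 → ℤ)), ∀ y ∈ bdryF latNbrs A,
      P {ω | E n ω = A ∧ Y (n + 1) ω = y} = W A y * P {ω | E n ω = A})
    (n : ℕ) (f : Finset (Fin 2 → ℤ) → ENNReal) :
    ∑' B, P {ω | E n ω = B} * f B ≤
      histExp (fun h y => W h.toFinset y) n fun h => f h.toFinset := by
  induction n generalizing f with
  | zero =>
    rw [tsum_eq_single {0} fun B hB => by simp [h0, hB.symm]]
    simp [h0, histExp]
  | succ n ih =>
    have hB : ∀ B, P {ω | E (n + 1) ω = B} ≤ ∑' A, ∑ y ∈ bdryF latNbrs A,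
        if insert y A = B then P {ω | E n ω = A ∧ Y (n + 1) ω = y} else 0 := by
      intro B
      have hsub : {ω | E (n + 1) ω = B} ⊆ ⋃ A, ⋃ y ∈ bdryF latNbrs A,
          {ω | insert y A = B ∧ E n ω = A ∧ Y (n + 1) ω = y} := by
        intro ω hω
        simp only [Set.mem_iUnion]
        exact ⟨E n ω, Y (n + 1) ω, hbd n ω, (hstep n ω).symm.trans hω, rfl, rfl⟩
      refine (measure_mono hsub).trans ((measure_iUnion_le _).trans ?_)
      refine ENNReal.tsum_le_tsum fun A => (measure_biUnion_finset_le _ _).trans ?_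
      refine Finset.sum_le_sum fun y _ => ?_
      split_ifs with h
      · exact measure_mono fun ω hω => hω.2
      · simp [h]
    calc ∑' B, P {ω | E (n + 1) ω = B} * f B
        ≤ ∑' B, (∑' A, ∑ y ∈ bdryF latNbrs A,
            if insert y A = B then P {ω | E n ω = A ∧ Y (n + 1) ω = y} else 0) * f B :=
          ENNReal.tsum_le_tsum fun B => mul_le_mul_left (hB B) _
      _ = ∑' A, ∑ y ∈ bdryF latNbrs A, P {ω | E n ω = A ∧ Y (n + 1) ω = y} * f (insert y A) := by
          simp only [← ENNReal.tsum_mul_right, Finset.sum_mul]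
          rw [ENNReal.tsum_comm]
          refine tsum_congr fun A => ?_
          rw [Summable.tsum_finsetSum fun _ _ => ENNReal.summable]
          refine Finset.sum_congr rfl fun y _ => ?_
          rw [tsum_eq_single (insert y A) fun B hB => by rw [if_neg hB.symm, zero_mul], if_pos rfl]
      _ = ∑' A, P {ω | E n ω = A} * ∑ y ∈ bdryF latNbrs A, W A y * f (insert y A) := by
          refine tsum_congr fun A => ?_
          rw [Finset.mul_sum]
          refine Finset.sum_congr rfl fun y hy => ?_
          rw [hlaw n A y hy]
          ring
      _ ≤ _ := by
          refine (ih _).trans (le_of_eq ?_)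
          simp only [histExp, List.toFinset_cons]

lemma measure_exists_le_eunorm_le {Ω : Type*} [MeasurableSpace Ω] (P : Measure Ω)
    [IsProbabilityMeasure P] {E : ℕ → Ω → Finset (Fin 2 → ℤ)} {Y : ℕ → Ω → (Fin 2 → ℤ)}
    {μh : Finset (Fin 2 → ℤ) → (Fin 2 → ℤ) → ℝ}
    (hμ : ∀ A : Finset (Fin 2 → ℤ), A.Nonempty → ∀ y ∈ A,
      Tendsto (fun x => hitMeas latNbrs (↑A) x y) cofinite (𝓝 (μh A y)))
    (h0 : ∀ ω, E 0 ω = {0})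
    (hstep : ∀ n ω, E (n + 1) ω = insert (Y (n + 1) ω) (E n ω))
    (hbd : ∀ n ω, Y (n + 1) ω ∈ bdryF latNbrs (E n ω))
    (hlaw : ∀ (n : ℕ) (A : Finset (Fin 2 → ℤ)), ∀ y ∈ bdryF latNbrs A,
      P {ω | E n ω = A ∧ Y (n + 1) ω = y}
        = ENNReal.ofReal (μh (bdryF latNbrs A) y) * P {ω | E n ω = A})
    {L : ℝ} (hL : 0 < L) (n j : ℕ) :
    P {ω | ∃ z ∈ E n ω, L + j ≤ eunorm z} ≤
      ENNReal.ofReal ((n + 1) * n.choose j * (4 * (48000144000 / √L)) ^ j) := by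
  classical
  have hsL : 0 < √L := Real.sqrt_pos.2 hL
  have hlim : ∀ A : Finset (Fin 2 → ℤ), ∀ y ∈ A,
      Tendsto (fun x => hitMeas latNbrs (↑A) x y) cofinite (𝓝 (μh A y)) :=
    fun A y hy => hμ A ⟨y, hy⟩ y hy
  have hw : ∀ h : List (Fin 2 → ℤ), IsHistory h → ∑ y ∈ bdryF latNbrs h.toFinset,
      ENNReal.ofReal (μh (bdryF latNbrs h.toFinset) y) ≤ 1 := by
    intro h _
    rw [← ENNReal.ofReal_sum_of_nonneg fun y hy =>
      ge_of_tendsto' (hlim _ y hy) fun x => hitMeas_nonneg latNbrs _ x y]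
    exact ENNReal.ofReal_le_one.2 (le_of_tendsto' (tendsto_finsetSum _ fun y hy => hlim _ y hy)
      fun x => sum_hitMeas_le_one latNbrs _ x)
  have hp : ∀ h : List (Fin 2 → ℤ), IsHistory h → (∃ z ∈ h, L ≤ eunorm z) →
      ∀ y ∈ bdryF latNbrs h.toFinset, ENNReal.ofReal (μh (bdryF latNbrs h.toFinset) y) ≤
        ENNReal.ofReal (48000144000 / √L) := by
    rintro h hh ⟨z, hz, hzL⟩ y hy
    exact ENNReal.ofReal_le_ofReal (hh.harmonic_le hz hL hzL hy (hlim _ y hy))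
  have hsub : {ω | ∃ z ∈ E n ω, L + j ≤ eunorm z} ⊆
      ⋃ B, {ω | E n ω = B ∧ ∃ z ∈ B, L + j ≤ eunorm z} := by
    intro ω hω
    exact Set.mem_iUnion.2 ⟨E n ω, rfl, hω⟩
  calc P {ω | ∃ z ∈ E n ω, L + j ≤ eunorm z}
      ≤ ∑' B, P {ω | E n ω = B ∧ ∃ z ∈ B, L + j ≤ eunorm z} :=
        (measure_mono hsub).trans (measure_iUnion_le _)
    _ ≤ ∑' B, P {ω | E n ω = B} * (if ∃ z ∈ B, L + j ≤ eunorm z then 1 else 0) := by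
        refine ENNReal.tsum_le_tsum fun B => ?_
        split_ifs with h
        · rw [mul_one]
          exact measure_mono fun ω hω => hω.1
        · simp [h]
    _ ≤ _ := tsum_measure_mul_le_histExp P h0 hstep hbd hlaw n _
    _ ≤ histExp (fun h y => ENNReal.ofReal (μh (bdryF latNbrs h.toFinset) y)) n
          fun h => ∑' x, chainCount L h j x := by
        refine histExp_mono _ n fun h hh => ?_
        split_ifs with hz
        · obtain ⟨z, hz, hzL⟩ := hz
          exact (hh.one_le_chainCount hL (List.mem_toFinset.1 hz) hzL).trans (ENNReal.le_tsum z)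
        · exact zero_le
    _ ≤ _ := histExp_tsum_chainCount_le hL hw hp n j
    _ = _ := by
        rw [ENNReal.ofReal_mul (by positivity), ENNReal.ofReal_mul (by positivity),
          ENNReal.ofReal_pow (by positivity), ENNReal.ofReal_mul (by norm_num)]
        rw [ENNReal.ofReal_add (by positivity) (by norm_num)]
        simp

/-- The arithmetic behind the choice of the exponent `2 / 3`. -/
lemma choose_mul_pow_le {C : ℝ} (hC : 1 ≤ C) {n j : ℕ} (hn : 1 ≤ n)
    (hj : 36 * C * (n : ℝ) ^ ((2 : ℝ) / 3) ≤ j) :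
    ((n : ℝ) + 1) * n.choose j * (4 * (C / √(j : ℝ))) ^ j ≤ 1440 * (1 / (n : ℝ) ^ 3) := by
  have hn1 : (1 : ℝ) ≤ n := by exact_mod_cast hn
  set m : ℝ := (n : ℝ) ^ ((2 : ℝ) / 3) with hm
  have hm1 : 1 ≤ m := Real.one_le_rpow hn1 (by norm_num)
  have hm3 : m ^ 3 = (n : ℝ) ^ 2 := by
    rw [hm, ← Real.rpow_natCast, ← Real.rpow_mul (by linarith)]
    norm_num
  have hjm : m ≤ j := by nlinarith
  have hj0 : (0 : ℝ) < j := by linarith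
  have hsj : 0 < √(j : ℝ) := Real.sqrt_pos.2 hj0
  have hsqrt : 36 * C * n ≤ j * √(j : ℝ) := by
    refine le_of_sq_le_sq ?_ (by positivity)
    rw [mul_pow (j : ℝ), Real.sq_sqrt hj0.le]
    calc (36 * C * n) ^ 2 = (36 * C) ^ 2 * m ^ 3 := by rw [hm3]; ring
      _ ≤ (36 * C) ^ 3 * m ^ 3 := by gcongr <;> linarith
      _ = (36 * C * m) ^ 3 := by ring
      _ ≤ (j : ℝ) ^ 3 := by gcongr
      _ = (j : ℝ) ^ 2 * j := by ring
  have hexp : Real.exp 1 ≤ 3 := by linarith [Real.exp_one_lt_d9]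
  have hfac : (j : ℝ) ^ j / j.factorial ≤ Real.exp j :=
    Real.pow_div_factorial_le_exp (j : ℝ) hj0.le j
  have hexpj : Real.exp j = Real.exp 1 ^ j := by rw [← Real.exp_nat_mul, mul_one]
  have hbase : (n : ℝ) * (4 * (C / √(j : ℝ))) / j * (Real.exp 1 * Real.exp 1) ≤ 1 := by
    have h9 : Real.exp 1 * Real.exp 1 ≤ 9 := by nlinarith [Real.exp_pos 1]
    have h1 : (n : ℝ) * (4 * (C / √(j : ℝ))) / j * 9 = 36 * C * n / (j * √(j : ℝ)) := by
      field_simp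
      ring
    calc _ ≤ (n : ℝ) * (4 * (C / √(j : ℝ))) / j * 9 := by gcongr
      _ ≤ 1 := by rw [h1]; exact div_le_one_of_le₀ hsqrt (by positivity)
  have hkey : (n.choose j : ℝ) * (4 * (C / √(j : ℝ))) ^ j * Real.exp j ≤ 1 := by
    calc (n.choose j : ℝ) * (4 * (C / √(j : ℝ))) ^ j * Real.exp j
        ≤ (n : ℝ) ^ j / j.factorial * (4 * (C / √(j : ℝ))) ^ j * Real.exp j := by
          gcongr
          exact Nat.choose_le_pow_div j n
      _ = (j : ℝ) ^ j / j.factorial * (((n : ℝ) * (4 * (C / √(j : ℝ))) / j) ^ j * Real.exp j) := by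
          generalize 4 * (C / √(j : ℝ)) = a
          rw [div_pow, mul_pow]
          field_simp
      _ ≤ Real.exp j * (((n : ℝ) * (4 * (C / √(j : ℝ))) / j) ^ j * Real.exp j) := by gcongr
      _ = ((n : ℝ) * (4 * (C / √(j : ℝ))) / j * (Real.exp 1 * Real.exp 1)) ^ j := by
          rw [hexpj, mul_pow, mul_pow]
          ring
      _ ≤ 1 := pow_le_one₀ (by positivity) hbase
  have hlow : (n : ℝ) ^ 4 / 720 ≤ Real.exp j := by
    have h1 := Real.pow_div_factorial_le_exp (j : ℝ) hj0.le 6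
    have h2 : (n : ℝ) ^ 4 ≤ (j : ℝ) ^ 6 := by
      calc (n : ℝ) ^ 4 = m ^ 6 := by rw [show m ^ 6 = (m ^ 3) ^ 2 by ring, hm3]; ring
        _ ≤ (j : ℝ) ^ 6 := by gcongr
    have h3 : ((Nat.factorial 6 : ℕ) : ℝ) = 720 := by norm_num [Nat.factorial]
    rw [h3] at h1
    linarith
  set q : ℝ := (n.choose j : ℝ) * (4 * (C / √(j : ℝ))) ^ j with hq
  have hq0 : 0 ≤ q := by positivity
  have h4 : q * ((n : ℝ) ^ 4 / 720) ≤ 1 := (mul_le_mul_of_nonneg_left hlow hq0).trans hkey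
  rw [mul_assoc, ← hq, mul_one_div, le_div_iff₀ (by positivity)]
  calc ((n : ℝ) + 1) * q * (n : ℝ) ^ 3 ≤ (n + n) * q * (n : ℝ) ^ 3 := by gcongr
    _ = 1440 * (q * ((n : ℝ) ^ 4 / 720)) := by ring
    _ ≤ 1440 := by linarith

lemma radE_le {d : ℕ} {A : Finset (Fin d → ℤ)} {r : ℝ} (hr : 0 ≤ r) (h : ∀ z ∈ A, eunorm z ≤ r) :
    radE A ≤ r :=
  Real.iSup_le (fun x => Real.iSup_le (fun hx => h x hx) hr) hr

/-- **External DLA on ℤ², growth of arms (Kesten).**  There is a constant `C(2) < ∞` such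
that almost surely `limsup_{n→∞} n^{-2/3} r(E_n) ≤ C(2)`. -/
theorem external_dla_arm_growth_Z2
    {Ω : Type*} [MeasurableSpace Ω] (P : Measure Ω) [IsProbabilityMeasure P]
    (E : ℕ → Ω → Finset (Fin 2 → ℤ)) (Y : ℕ → Ω → (Fin 2 → ℤ))
    -- `μh A` is the harmonic measure from infinity of a finite set `A ⊆ ℤ²`:
    -- the limit as `|x| → ∞` of the hitting distribution `H_A(x,·)` of SRW (recurrent case)
    (μh : Finset (Fin 2 → ℤ) → (Fin 2 → ℤ) → ℝ)
    (hμ : ∀ A : Finset (Fin 2 → ℤ), A.Nonempty → ∀ y ∈ A,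
      Tendsto (fun x => hitMeas latNbrs (↑A) x y) cofinite (𝓝 (μh A y)))
    -- dynamics of the external DLA Markov chain, started from the origin
    (h0 : ∀ ω, E 0 ω = {0})
    (hstep : ∀ n ω, E (n+1) ω = insert (Y (n+1) ω) (E n ω))
    (hbd : ∀ n ω, Y (n+1) ω ∈ bdryF latNbrs (E n ω))
    -- the new vertex is chosen according to the harmonic measure from infinity of `∂E_n`
    (hlaw : ∀ (n : ℕ) (A : Finset (Fin 2 → ℤ)), ∀ y ∈ bdryF latNbrs A,
      P {ω | E n ω = A ∧ Y (n+1) ω = y}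
        = ENNReal.ofReal (μh (bdryF latNbrs A) y) * P {ω | E n ω = A}) :
    ∃ C : ℝ, ∀ᵐ ω ∂P,
      Filter.limsup (fun n : ℕ => (((n : ℝ) ^ (-(2:ℝ)/3) * radE (E n ω) : ℝ) : EReal)) atTop
        ≤ (C : EReal) := by
  set K : ℝ := 36 * 48000144000 with hK
  let j : ℕ → ℕ := fun n => ⌈K * (n : ℝ) ^ ((2 : ℝ) / 3)⌉₊
  let bad : ℕ → Set Ω := fun n => {ω | ∃ z ∈ E n ω, (j n : ℝ) + j n ≤ eunorm z}
  have hbad : ∀ n : ℕ, P (bad (n + 1)) ≤ ENNReal.ofReal (1440 * (1 / ((n + 1 : ℕ) : ℝ) ^ 3)) := by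
    intro n
    have hj : K * ((n + 1 : ℕ) : ℝ) ^ ((2 : ℝ) / 3) ≤ j (n + 1) := Nat.le_ceil _
    have hj0 : (0 : ℝ) < j (n + 1) := lt_of_lt_of_le (by positivity) hj
    exact (measure_exists_le_eunorm_le P hμ h0 hstep hbd hlaw hj0 (n + 1) (j (n + 1))).trans
      (ENNReal.ofReal_le_ofReal (choose_mul_pow_le (by norm_num) (by omega) hj))
  have hsum : ∑' n, P (bad (n + 1)) ≠ ⊤ := by
    have hs : Summable fun n : ℕ => 1440 * (1 / ((n + 1 : ℕ) : ℝ) ^ 3) :=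
      ((summable_nat_add_iff (f := fun n : ℕ => 1 / (n : ℝ) ^ 3) 1).2
        (Real.summable_one_div_nat_pow.2 (by norm_num))).mul_left _
    exact ne_top_of_le_ne_top hs.tsum_ofReal_ne_top (ENNReal.tsum_le_tsum hbad)
  refine ⟨2 * (K + 1), ?_⟩
  filter_upwards [ae_eventually_notMem hsum] with ω hω
  refine limsup_le_of_le (by isBoundedDefault) ?_
  rw [← eventually_map (m := fun n => n + 1) (P := fun n => ω ∉ bad n), map_add_atTop_eq_nat] at hω
  filter_upwards [hω, eventually_ge_atTop 1] with n hn hn1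
  have hn1' : (1 : ℝ) ≤ n := by exact_mod_cast hn1
  have hm1 : (1 : ℝ) ≤ (n : ℝ) ^ ((2 : ℝ) / 3) := Real.one_le_rpow hn1' (by norm_num)
  have hrad : radE (E n ω) ≤ (j n : ℝ) + j n := by
    refine radE_le (by positivity) fun z hz => ?_
    by_contra! hcon
    exact hn ⟨z, hz, hcon.le⟩
  have hjn : (j n : ℝ) < K * (n : ℝ) ^ ((2 : ℝ) / 3) + 1 := Nat.ceil_lt_add_one (by positivity)
  have hinv : (n : ℝ) ^ (-(2 : ℝ) / 3) * (n : ℝ) ^ ((2 : ℝ) / 3) = 1 := by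
    rw [← Real.rpow_add (by linarith)]
    norm_num
  rw [EReal.coe_le_coe_iff]
  calc (n : ℝ) ^ (-(2 : ℝ) / 3) * radE (E n ω)
      ≤ (n : ℝ) ^ (-(2 : ℝ) / 3) * (2 * (K + 1) * (n : ℝ) ^ ((2 : ℝ) / 3)) := by
        gcongr
        linarith
    _ = 2 * (K + 1) * ((n : ℝ) ^ (-(2 : ℝ) / 3) * (n : ℝ) ^ ((2 : ℝ) / 3)) := by ring
    _ = 2 * (K + 1) := by rw [hinv, mul_one]
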